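/- arXiv:2110.08040 — 3 statements merged into one kernel-verified Lean document; each statement's English description precedes it below -/
import Mathlib

section
/- Assume conditions (M), (O), (R), (P). Let μ ∈ Cm, U := μ/∼, 0_U := ⋀U, and a ∈ A. If (1,a) ∈ μ⁺ but (1,a) ∉ 0_U, then Θ(1,a) ⊔ 0_U covers 0_U; that is, Θ(1,a) ⊔ 0_U is an atom of the interval [0_U, μ⁺] of C. (This is Lemma 12 of the paper.) -/
variable {A : Type*}

/-- `η` is a completely meet irreducible member of `C`, with (unique) cover `p` in `C`. -/
def IsCMI (C : Set (Setoid A)) (η p : Setoid A) : Prop :=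
  η ∈ C ∧ p ∈ C ∧ η < p ∧ ∀ β ∈ C, η < β → p ≤ β

/-- A single up or down transposition between the intervals `I[pq.1, pq.2]`
and `I[rs.1, rs.2]` of `C`. -/
def Persp (C : Set (Setoid A)) (pq rs : Setoid A × Setoid A) : Prop :=
  pq.1 ∈ C ∧ pq.2 ∈ C ∧ rs.1 ∈ C ∧ rs.2 ∈ C ∧
    ((pq.1 = pq.2 ⊓ rs.1 ∧ rs.2 = pq.2 ⊔ rs.1) ∨
      (rs.1 = rs.2 ⊓ pq.1 ∧ pq.2 = rs.2 ⊔ pq.1))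

/-- Projectivity of intervals of `C`: a finite chain of up and down transpositions. -/
def Projective (C : Set (Setoid A)) : Setoid A × Setoid A → Setoid A × Setoid A → Prop :=
  Relation.ReflTransGen (Persp C)

/-- Prime interval projectivity `φ ∼ ψ`: the prime intervals `I[φ,φ⁺]` and `I[ψ,ψ⁺]`
over completely meet irreducible members of `C` are projective. -/
def PIP (C : Set (Setoid A)) (φ ψ : Setoid A) : Prop :=
  ∃ p q, IsCMI C φ p ∧ IsCMI C ψ q ∧ Projective C (φ, p) (ψ, q)

/-- `Θ(a,b)`: the least member of `C` containing the pair `(a, b)`. -/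
def theta (C : Set (Setoid A)) (a b : A) : Setoid A :=
  sInf {s | s ∈ C ∧ s.r a b}

/-- The relation `φ • ψ`: the pairs of `p = φ⁺ = ψ⁺` on which `φ` and `ψ` agree
(the complement of the symmetric difference of `φ` and `ψ` intersected with `p`). -/
def Bul (p φ ψ : Setoid A) (x y : A) : Prop :=
  p.r x y ∧ (φ.r x y ↔ ψ.r x y)


/-- The standing hypotheses. -/
structure Ctx (one : A) (C : Set (Setoid A)) : Prop where
  hInf : ∀ S ⊆ C, sInf S ∈ C
  hSup : ∀ S ⊆ C, sSup S ∈ C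
  hDir : ∀ D ⊆ C, D.Nonempty → DirectedOn (· ≤ ·) D →
      ∀ x y : A, (sSup D).r x y ↔ ∃ s ∈ D, s.r x y
  hM : ∀ x ∈ C, ∀ y ∈ C, ∀ z ∈ C, x ≤ z → x ⊔ y ⊓ z = (x ⊔ y) ⊓ z
  hO : ∀ α ∈ C, ∀ a b : A, α ⊔ theta C one a = α ⊔ theta C one b ↔ α.r a b
  hR : ∀ α ∈ C, ∀ β ∈ C, (∀ x : A, α.r one x ↔ β.r one x) → α = β
  hP : ∀ φ ψ p q : Setoid A, IsCMI C φ p → IsCMI C ψ q →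
      Projective C (φ, p) (ψ, q) → p = q

/-- `y` covers `x` in `C`. -/
def Cov (C : Set (Setoid A)) (x y : Setoid A) : Prop :=
  x ∈ C ∧ y ∈ C ∧ x < y ∧ ∀ z ∈ C, x ≤ z → z ≤ y → z = x ∨ z = y

/-- Members of the class of `μ`. -/
def VV (C : Set (Setoid A)) (μ p φ : Setoid A) : Prop :=
  IsCMI C φ p ∧ Projective C (φ, p) (μ, p)

/-- Equal, or there is a third element of the class above the meet. -/
def TT (C : Set (Setoid A)) (μ p φ ψ : Setoid A) : Prop :=
  φ = ψ ∨ ∃ D, VV C μ p D ∧ φ ⊓ ψ ≤ D ∧ D ≠ φ ∧ D ≠ ψ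

namespace Ctx

variable {one : A} {C : Set (Setoid A)} {μ p : Setoid A}

theorem inf (h : Ctx one C) {x y : Setoid A} (hx : x ∈ C) (hy : y ∈ C) : x ⊓ y ∈ C := by
  rw [← sInf_pair]; exact h.hInf _ (by rintro z (rfl | rfl) <;> assumption)

theorem sup (h : Ctx one C) {x y : Setoid A} (hx : x ∈ C) (hy : y ∈ C) : x ⊔ y ∈ C := by
  rw [← sSup_pair]; exact h.hSup _ (by rintro z (rfl | rfl) <;> assumption)

theorem theta_mem (h : Ctx one C) (a b : A) : theta C a b ∈ C :=
  h.hInf _ (fun _ hs => hs.1)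

theorem theta_r (a b : A) : (theta C a b).r a b := fun _ hs => hs.2

theorem theta_le {a b : A} {s : Setoid A} (hs : s ∈ C) (hr : s.r a b) : theta C a b ≤ s :=
  sInf_le ⟨hs, hr⟩

theorem exists_of_not_le (h : Ctx one C) {x y : Setoid A} (hx : x ∈ C) (hy : y ∈ C)
    (hn : ¬ y ≤ x) : ∃ e, y.r one e ∧ ¬ x.r one e := by
  by_contra hc
  push Not at hc
  apply hn
  have : y = y ⊓ x := by
    apply h.hR _ hy _ (h.inf hy hx)
    intro e
    exact ⟨fun he => ⟨he, hc e he⟩, fun he => he.1⟩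
  rw [this]; exact inf_le_right

theorem exists_cmi (h : Ctx one C) {x y : Setoid A} (hx : x ∈ C) (hy : y ∈ C)
    (hn : ¬ y ≤ x) : ∃ η q, IsCMI C η q ∧ x ≤ η ∧ ¬ y ≤ η := by
  obtain ⟨e, he, hxe⟩ := h.exists_of_not_le hx hy hn
  obtain ⟨η, hxη, hη⟩ := zorn_le_nonempty₀ {s : Setoid A | s ∈ C ∧ ¬ s.r one e} (by
    intro c hc hch z hz
    have hcC : c ⊆ C := fun s hs => (hc hs).1
    refine ⟨sSup c, ⟨h.hSup _ hcC, ?_⟩, fun z hz => le_sSup hz⟩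
    rw [h.hDir c hcC ⟨z, hz⟩ hch.directedOn]
    rintro ⟨s, hs, hse⟩
    exact (hc hs).2 hse) x ⟨hx, hxe⟩
  have hηC := hη.prop.1
  refine ⟨η, η ⊔ theta C one e, ⟨hηC, h.sup hηC (h.theta_mem _ _), ?_, ?_⟩, hxη, ?_⟩
  · refine lt_of_le_of_ne le_sup_left fun hh => hη.prop.2 ?_
    have : theta C one e ≤ η := by rw [hh]; exact le_sup_right
    exact this (theta_r one e)
  · intro β hβ hlt
    refine sup_le hlt.le (theta_le hβ ?_)
    by_contra hne
    exact absurd (hη.le_of_ge ⟨hβ, hne⟩ hlt.le) (not_le_of_gt hlt)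
  · intro hle
    exact hη.prop.2 (hle he)

theorem cov_up (h : Ctx one C) {x y x' y' : Setoid A} (hc : Cov C x y) (hx' : x' ∈ C)
    (e1 : x = y ⊓ x') (e2 : y' = y ⊔ x') : Cov C x' y' := by
  obtain ⟨hx, hy, hlt, hz⟩ := hc
  refine ⟨hx', e2 ▸ h.sup hy hx', ?_, ?_⟩
  · rw [e2]
    refine lt_of_le_of_ne le_sup_right fun hh => hlt.ne ?_
    rw [e1]; exact inf_eq_left.2 (by rw [hh]; exact le_sup_left)
  · intro z hzC h1 h2
    have hm := h.hM x' hx' y hy z hzC h1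
    have hz2 : x' ⊔ y ⊓ z = z := by
      rw [hm]; apply inf_eq_right.2; rw [sup_comm, ← e2]; exact h2
    rcases hz (y ⊓ z) (h.inf hy hzC) (by rw [e1]; exact inf_le_inf_left _ h1) inf_le_left
      with h3 | h3
    · left; rw [← hz2, h3, e1]; exact sup_eq_left.2 inf_le_right
    · right; rw [← hz2, h3, e2, sup_comm]

theorem cov_down (h : Ctx one C) {x y x' y' : Setoid A} (hc : Cov C x' y') (hy : y ∈ C)
    (e1 : x = y ⊓ x') (e2 : y' = y ⊔ x') : Cov C x y := by
  obtain ⟨hx', hy', hlt, hz⟩ := hc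
  refine ⟨e1 ▸ h.inf hy hx', hy, ?_, ?_⟩
  · rw [e1]
    refine lt_of_le_of_ne inf_le_left fun hh => hlt.ne ?_
    rw [e2]; exact (sup_eq_right.2 (inf_eq_left.1 hh)).symm
  · intro z hzC h1 h2
    have hm := h.hM z hzC x' hx' y hy h2
    have hz2 : (z ⊔ x') ⊓ y = z := by
      rw [← hm]; apply sup_eq_left.2; rw [inf_comm, ← e1]; exact h1
    rcases hz (z ⊔ x') (h.sup hzC hx') le_sup_right (by rw [e2]; exact sup_le_sup_right h2 _)
      with h3 | h3
    · left; rw [← hz2, h3, e1, inf_comm]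
    · right; rw [← hz2, h3, e2]; exact inf_eq_right.2 le_sup_left

theorem persp_symm {I J : Setoid A × Setoid A} (hp : Persp C I J) : Persp C J I := by
  obtain ⟨a, b, c, d, e⟩ := hp
  exact ⟨c, d, a, b, e.symm⟩

theorem cmi_cov {η q : Setoid A} (hc : IsCMI C η q) : Cov C η q := by
  obtain ⟨a, b, c, d⟩ := hc
  refine ⟨a, b, c, fun z hz h1 h2 => ?_⟩
  rcases h1.eq_or_lt with h3 | h3
  · exact Or.inl h3.symm
  · exact Or.inr (le_antisymm h2 (d z hz h3))

theorem lemS (h : Ctx one C) (hμ : IsCMI C μ p) {x y η q : Setoid A} (hc : Cov C x y)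
    (hpr : Projective C (x, y) (μ, p)) (hη : IsCMI C η q) (h1 : x ≤ η) (h2 : ¬ y ≤ η) :
    VV C μ p η ∧ y ⊔ η = p ∧ y ⊓ η = x := by
  have hηC := hη.1
  have e1 : y ⊓ η = x := by
    rcases hc.2.2.2 (y ⊓ η) (h.inf hc.2.1 hηC) (le_inf hc.2.2.1.le h1) inf_le_left with h3 | h3
    · exact h3
    · exact absurd (inf_eq_left.1 h3) h2
  have c2 : Cov C η (y ⊔ η) := h.cov_up hc hηC e1.symm rfl
  have e2 : q = y ⊔ η := by
    rcases c2.2.2.2 q hη.2.1 hη.2.2.1.le (hη.2.2.2 _ c2.2.1 c2.2.2.1) with h3 | h3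
    · exact absurd h3 hη.2.2.1.ne'
    · exact h3
  have hpj : Projective C (η, q) (μ, p) :=
    Relation.ReflTransGen.head (b := (x, y))
      ⟨hηC, hη.2.1, hc.1, hc.2.1, Or.inr ⟨e1.symm, e2⟩⟩ hpr
  have e3 : q = p := h.hP _ _ _ _ hη hμ hpj
  subst e3
  exact ⟨⟨hη, hpj⟩, e2.symm, e1⟩

theorem V_le {φ ψ : Setoid A} (h1 : VV C μ p φ) (h2 : VV C μ p ψ) (hle : φ ≤ ψ) : φ = ψ := by
  rcases hle.eq_or_lt with h3 | h3
  · exact h3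
  · exact absurd (h1.1.2.2.2 _ h2.1.1 h3) (not_le_of_gt h2.1.2.2.1)

theorem V_sup (h : Ctx one C) {φ D : Setoid A} (h1 : VV C μ p φ) (hD : D ∈ C) (hDp : D ≤ p)
    (hn : ¬ D ≤ φ) : φ ⊔ D = p := by
  apply le_antisymm (sup_le h1.1.2.2.1.le hDp)
  exact h1.1.2.2.2 _ (h.sup h1.1.1 hD) (left_lt_sup.2 hn)

theorem V_cov (h : Ctx one C) {φ ψ : Setoid A} (h1 : VV C μ p φ) (h2 : VV C μ p ψ)
    (hne : φ ≠ ψ) : Cov C (φ ⊓ ψ) φ := by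
  refine h.cov_down (cmi_cov h2.1) h1.1.1 rfl ?_
  rw [sup_comm]
  exact (h.V_sup h2 h1.1.1 h1.1.2.2.1.le (fun hh => hne (V_le h1 h2 hh))).symm

theorem third (h : Ctx one C) (hμ : IsCMI C μ p) {φ ψ D : Setoid A} (h1 : VV C μ p φ)
    (h2 : VV C μ p ψ) (hne : φ ≠ ψ) (hD : D ∈ C) (hDp : D ≤ p) (ha : φ ⊓ ψ ≤ D)
    (hb : φ ⊓ D ≤ ψ) (hn : ¬ D ≤ φ) : VV C μ p D := by
  have s1 := h.V_sup h1 hD hDp hn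
  have s2 : φ ⊔ ψ = p := h.V_sup h1 h2.1.1 h2.1.2.2.1.le (fun hh => hne (V_le h2 h1 hh).symm)
  have e : φ ⊓ ψ = φ ⊓ D := le_antisymm (le_inf inf_le_left ha) (le_inf inf_le_left hb)
  have hi := h.inf h1.1.1 h2.1.1
  have c1 := h.V_cov h1 h2 hne
  have c2 : Cov C D p := h.cov_up c1 hD e s1.symm
  have pr : Projective C (D, p) (μ, p) :=
    Relation.ReflTransGen.head (b := (φ ⊓ ψ, φ))
      ⟨hD, c2.2.1, hi, h1.1.1, Or.inr ⟨e, s1.symm⟩⟩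
      (Relation.ReflTransGen.head (b := (ψ, p))
        ⟨hi, h1.1.1, h2.1.1, c2.2.1, Or.inl ⟨rfl, s2.symm⟩⟩ h2.2)
  obtain ⟨η, q, hη, k1, k2⟩ := h.exists_cmi hD c2.2.1 (not_le_of_gt c2.2.2.1)
  obtain ⟨v, -, k3⟩ := h.lemS hμ c2 pr hη k1 k2
  have : η = D := by rw [← k3]; exact (inf_eq_right.2 v.1.2.2.1.le).symm
  exact this ▸ v

theorem char (h : Ctx one C) {φ ψ D : Setoid A} (h1 : VV C μ p φ)
    (h2 : VV C μ p ψ) (hD : VV C μ p D) (hne : φ ≠ ψ) (ha : φ ⊓ ψ ≤ D) (n1 : D ≠ φ) :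
    φ ⊓ D ≤ ψ := by
  rcases (h.V_cov h1 h2 hne).2.2.2 (φ ⊓ D) (h.inf h1.1.1 hD.1.1) (le_inf inf_le_left ha)
    inf_le_left with h3 | h3
  · rw [h3]; exact inf_le_right
  · exact absurd (V_le h1 hD (inf_eq_left.1 h3)).symm n1

theorem V_rel (h : Ctx one C) {φ : Setoid A} (h1 : VV C μ p φ) {a b : A}
    (ha : p.r one a) (hb : p.r one b) (na : ¬ φ.r one a) (nb : ¬ φ.r one b) : φ.r a b := by
  rw [← h.hO φ h1.1.1]
  rw [h.V_sup h1 (h.theta_mem _ _) (theta_le h1.1.2.1 ha) (fun hh => na (hh (theta_r _ _))),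
    h.V_sup h1 (h.theta_mem _ _) (theta_le h1.1.2.1 hb) (fun hh => nb (hh (theta_r _ _)))]

theorem char_r (h : Ctx one C) {φ ψ D : Setoid A} (h1 : VV C μ p φ)
    (h2 : VV C μ p ψ) (hD : VV C μ p D) (hne : φ ≠ ψ) (ha : φ ⊓ ψ ≤ D) (n1 : D ≠ φ)
    (n2 : D ≠ ψ) {x : A} (hx : p.r one x) (x1 : ¬ φ.r one x) (x2 : ¬ ψ.r one x) :
    D.r one x := by
  have c2 := h.char h2 h1 hD hne.symm (by rwa [inf_comm]) n2
  obtain ⟨e, he, ne⟩ := h.exists_of_not_le h1.1.1 hD.1.1 (fun hh => n1 (V_le hD h1 hh))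
  have ne2 : ¬ ψ.r one e := fun hh => ne (c2 ⟨hh, he⟩)
  have hep : p.r one e := hD.1.2.2.1.le he
  have r : D.r e x := ha ⟨h.V_rel h1 hep hx ne x1, h.V_rel h2 hep hx ne2 x2⟩
  exact D.iseqv.trans he r

theorem T_symm {φ ψ : Setoid A} (ht : TT C μ p φ ψ) : TT C μ p ψ φ := by
  rcases ht with rfl | ⟨D, h1, h2, h3, h4⟩
  · exact Or.inl rfl
  · exact Or.inr ⟨D, h1, by rwa [inf_comm], h4, h3⟩

theorem T_trans (h : Ctx one C) (hμ : IsCMI C μ p) {φ₁ φ₂ φ₃ : Setoid A} (v1 : VV C μ p φ₁)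
    (v2 : VV C μ p φ₂) (v3 : VV C μ p φ₃) (t1 : TT C μ p φ₁ φ₂) (t2 : TT C μ p φ₂ φ₃) :
    TT C μ p φ₁ φ₃ := by
  by_cases n13 : φ₁ = φ₃
  · exact Or.inl n13
  by_cases n12 : φ₁ = φ₂
  · exact n12 ▸ t2
  by_cases n23 : φ₂ = φ₃
  · exact n23 ▸ t1
  right
  obtain ⟨β, vβ, b0, b1, b2⟩ := t1.resolve_left n12
  obtain ⟨γ, vγ, g0, g1, g2⟩ := t2.resolve_left n23
  by_cases hle : φ₁ ⊓ φ₃ ≤ φ₂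
  · exact ⟨φ₂, v2, hle, fun e => n12 e.symm, n23⟩
  have c1 : φ₁ ⊓ β ≤ φ₂ := h.char v1 v2 vβ n12 b0 b1
  have c2 : φ₂ ⊓ β ≤ φ₁ := h.char v2 v1 vβ (Ne.symm n12) (by rwa [inf_comm]) b2
  have c3 : φ₂ ⊓ γ ≤ φ₃ := h.char v2 v3 vγ n23 g0 g1
  have c4 : φ₃ ⊓ γ ≤ φ₂ := h.char v3 v2 vγ (Ne.symm n23) (by rwa [inf_comm]) g2
  have key : ¬ β ⊓ γ ≤ φ₁ := by
    intro hk
    have nb : β ≠ γ := by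
      rintro rfl
      rw [inf_idem] at hk
      exact b1 (V_le vβ v1 hk)
    have k2 : β ⊓ γ ≤ φ₂ := (le_inf hk inf_le_left).trans c1
    rcases (h.V_cov vβ vγ nb).2.2.2 (φ₁ ⊓ φ₂) (h.inf v1.1.1 v2.1.1) (le_inf hk k2) b0
      with e | e
    · have k3 : φ₁ ⊓ φ₂ ≤ φ₃ := (le_inf inf_le_right (e.le.trans inf_le_right)).trans c3
      rcases (h.V_cov v1 v2 n12).2.2.2 (φ₁ ⊓ φ₃) (h.inf v1.1.1 v3.1.1)
        (le_inf inf_le_left k3) inf_le_left with e | e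
      · exact hle (e.le.trans inf_le_right)
      · exact n13 (V_le v1 v3 (inf_eq_left.1 e))
    · exact b1 (V_le vβ v1 (e.ge.trans inf_le_left))
  have m1 := h.inf v1.1.1 v3.1.1
  have m2 := h.inf vβ.1.1 vγ.1.1
  have hb : φ₁ ⊓ (φ₁ ⊓ φ₃ ⊔ β ⊓ γ) ≤ φ₃ := by
    rw [inf_comm, ← h.hM _ m1 _ m2 _ v1.1.1 inf_le_left]
    refine sup_le inf_le_right ?_
    have k : β ⊓ γ ⊓ φ₁ ≤ φ₂ :=
      (le_inf inf_le_right (inf_le_left.trans inf_le_left)).trans c1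
    exact (le_inf k (inf_le_left.trans inf_le_right)).trans c3
  have hn : ¬ φ₁ ⊓ φ₃ ⊔ β ⊓ γ ≤ φ₁ := fun hh => key (le_sup_right.trans hh)
  refine ⟨φ₁ ⊓ φ₃ ⊔ β ⊓ γ, ?_, le_sup_left, fun e => hn e.le, ?_⟩
  · exact h.third hμ v1 v3 n13 (h.sup m1 m2)
      (sup_le (inf_le_left.trans v1.1.2.2.1.le) (inf_le_left.trans vβ.1.2.2.1.le))
      le_sup_left hb hn
  · intro e
    have k : β ⊓ γ ≤ φ₃ := le_sup_right.trans e.le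
    have k2 : β ⊓ γ ≤ φ₂ := (le_inf k inf_le_right).trans c4
    exact key ((le_inf k2 inf_le_left).trans c2)

theorem T_same (h : Ctx one C) (hμ : IsCMI C μ p) {x y φ ψ : Setoid A} (hc : Cov C x y)
    (hpr : Projective C (x, y) (μ, p)) (v1 : VV C μ p φ) (v2 : VV C μ p ψ)
    (a1 : x ≤ φ) (a2 : ¬ y ≤ φ) (b1 : x ≤ ψ) (b2 : ¬ y ≤ ψ) : TT C μ p φ ψ := by
  by_cases hne : φ = ψ
  · exact Or.inl hne
  obtain ⟨-, s1, e1⟩ := h.lemS hμ hc hpr v1.1 a1 a2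
  have m := h.inf v1.1.1 v2.1.1
  have hn : ¬ φ ⊓ ψ ⊔ y ≤ φ := fun hh => a2 (le_sup_right.trans hh)
  refine Or.inr ⟨φ ⊓ ψ ⊔ y, ?_, le_sup_left, fun e => hn e.le,
    fun e => b2 (le_sup_right.trans e.le)⟩
  refine h.third hμ v1 v2 hne (h.sup m hc.2.1)
    (sup_le (inf_le_left.trans v1.1.2.2.1.le) (s1 ▸ le_sup_left)) le_sup_left ?_ hn
  rw [inf_comm, ← h.hM _ m _ hc.2.1 _ v1.1.1 inf_le_left, e1]
  exact sup_le inf_le_right b1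

theorem chain (h : Ctx one C) (hμ : IsCMI C μ p) {I : Setoid A × Setoid A}
    (hI : Projective C I (μ, p)) :
    Cov C I.1 I.2 ∧ ∀ φ, VV C μ p φ → I.1 ≤ φ → ¬ I.2 ≤ φ → TT C μ p φ μ := by
  have vμ : VV C μ p μ := ⟨hμ, Relation.ReflTransGen.refl⟩
  induction hI using Relation.ReflTransGen.head_induction_on with
  | refl => exact ⟨cmi_cov hμ, fun φ v h1 _ => Or.inl (V_le vμ v h1).symm⟩
  | @head I J hIJ hJ ih =>
    obtain ⟨cJ, ih⟩ := ih
    obtain ⟨i1, i2, j1, j2, ⟨e1, e2⟩ | ⟨e1, e2⟩⟩ := id hIJ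
    · have cI := h.cov_down cJ i2 e1 e2
      refine ⟨cI, fun φ v h1 h2 => ?_⟩
      obtain ⟨η, q, hη, k1, k2⟩ := h.exists_cmi j1 j2 (not_le_of_gt cJ.2.2.1)
      obtain ⟨vη, -, -⟩ := h.lemS hμ cJ hJ hη k1 k2
      refine h.T_trans hμ v vη vμ ?_ (ih η vη k1 k2)
      refine h.T_same hμ cI (Relation.ReflTransGen.head hIJ hJ) v vη h1 h2 ?_ ?_
      · rw [e1]; exact inf_le_right.trans k1
      · intro hh; apply k2; rw [e2]; exact sup_le hh k1
    · refine ⟨h.cov_up cJ i1 e1 e2, fun φ v h1 h2 => ih φ v ?_ ?_⟩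
      · rw [e1]; exact inf_le_right.trans h1
      · intro hh; apply h2; rw [e2]; exact sup_le hh h1

theorem T_all (h : Ctx one C) (hμ : IsCMI C μ p) {φ ψ : Setoid A} (v1 : VV C μ p φ)
    (v2 : VV C μ p ψ) : TT C μ p φ ψ := by
  have vμ : VV C μ p μ := ⟨hμ, Relation.ReflTransGen.refl⟩
  exact h.T_trans hμ v1 vμ v2
    ((h.chain hμ v1.2).2 φ v1 le_rfl (not_le_of_gt v1.1.2.2.1))
    (T_symm ((h.chain hμ v2.2).2 ψ v2 le_rfl (not_le_of_gt v2.1.2.2.1)))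

theorem PIP_V (h : Ctx one C) (hμ : IsCMI C μ p) {ψ : Setoid A} (hp : PIP C ψ μ) :
    VV C μ p ψ := by
  obtain ⟨p', q', h1, h2, h3⟩ := hp
  have e : q' = p := le_antisymm (h2.2.2.2 _ hμ.2.1 hμ.2.2.1) (hμ.2.2.2 _ h2.2.1 h2.2.2.1)
  subst e
  have e := h.hP _ _ _ _ h1 h2 h3
  subst e
  exact ⟨h1, h3⟩

end Ctx

/-- Lemma 12: if `(1,a) ∈ μ⁺ \ 0_U` where `U = μ/∼` and `0_U = ⋀U`, then
`Θ(1,a) ⊔ 0_U` is an atom of the interval `[0_U, μ⁺]` of `C`, i.e. it covers `0_U`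
in `C`. -/
theorem stmt9 (one : A) (C : Set (Setoid A))
    (hInf : ∀ S ⊆ C, sInf S ∈ C) (hSup : ∀ S ⊆ C, sSup S ∈ C)
    (hDir : ∀ D ⊆ C, D.Nonempty → DirectedOn (· ≤ ·) D →
      ∀ x y : A, (sSup D).r x y ↔ ∃ s ∈ D, s.r x y)
    (hM : ∀ x ∈ C, ∀ y ∈ C, ∀ z ∈ C, x ≤ z → x ⊔ y ⊓ z = (x ⊔ y) ⊓ z)
    (hO : ∀ α ∈ C, ∀ a b : A, α ⊔ theta C one a = α ⊔ theta C one b ↔ α.r a b)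
    (hR : ∀ α ∈ C, ∀ β ∈ C, (∀ x : A, α.r one x ↔ β.r one x) → α = β)
    (hP : ∀ φ ψ p q : Setoid A, IsCMI C φ p → IsCMI C ψ q →
      Projective C (φ, p) (ψ, q) → p = q)
    (μ p : Setoid A) (hμ : IsCMI C μ p) (a : A)
    (h1 : p.r one a) (h2 : ¬ (sInf {ψ | PIP C ψ μ}).r one a) :
    sInf {ψ | PIP C ψ μ} < theta C one a ⊔ sInf {ψ | PIP C ψ μ} ∧
    theta C one a ⊔ sInf {ψ | PIP C ψ μ} ≤ p ∧
    ∀ γ ∈ C, sInf {ψ | PIP C ψ μ} < γ →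
      γ < theta C one a ⊔ sInf {ψ | PIP C ψ μ} → False := by
  have h : Ctx one C := ⟨hInf, hSup, hDir, hM, hO, hR, hP⟩
  set Z := sInf {ψ | PIP C ψ μ} with hZ
  have hV : ∀ {ψ}, PIP C ψ μ → VV C μ p ψ := fun hp => h.PIP_V hμ hp
  have hZC : Z ∈ C := hInf _ (fun ψ hψ => (hV hψ).1.1)
  have hZμ : Z ≤ μ := sInf_le ⟨p, p, hμ, hμ, Relation.ReflTransGen.refl⟩
  refine ⟨?_, sup_le (Ctx.theta_le hμ.2.1 h1) (hZμ.trans hμ.2.2.1.le), ?_⟩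
  · refine right_lt_sup.2 fun hh => h2 (hh (Ctx.theta_r _ _))
  intro γ hγ hlt hγδ
  obtain ⟨b, hb, nb⟩ := h.exists_of_not_le hZC hγ (not_le_of_gt hlt)
  have hab : ∀ ψ, PIP C ψ μ → ψ.r one a → ψ.r one b := by
    intro ψ hψ ha
    have : theta C one a ⊔ Z ≤ ψ := sup_le (Ctx.theta_le (hV hψ).1.1 ha) (sInf_le hψ)
    exact this (hγδ.le hb)
  have hbp : p.r one b :=
    (sup_le (Ctx.theta_le hμ.2.1 h1) (hZμ.trans hμ.2.2.1.le) : theta C one a ⊔ Z ≤ p)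
      (hγδ.le hb)
  obtain ⟨ψ', hψ', nψ'⟩ : ∃ ψ, PIP C ψ μ ∧ ¬ ψ.r one b := by
    by_contra hc
    push Not at hc
    exact nb (fun ψ hψ => hc ψ hψ)
  have hba : ∀ ψ, PIP C ψ μ → ψ.r one b → ψ.r one a := by
    intro ψ hψ hbψ
    by_contra na
    have na' : ¬ ψ'.r one a := fun hh => nψ' (hab ψ' hψ' hh)
    have hne : ψ ≠ ψ' := by rintro rfl; exact nψ' hbψ
    obtain ⟨D, vD, d0, d1, d2⟩ := (h.T_all hμ (hV hψ) (hV hψ')).resolve_left hne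
    have Da := h.char_r (hV hψ) (hV hψ') vD hne d0 d1 d2 h1 na na'
    have Db := hab D ⟨p, p, vD.1, hμ, vD.2⟩ Da
    exact nψ' (h.char (hV hψ) (hV hψ') vD hne d0 d1 ⟨hbψ, Db⟩)
  have hZab : Z.r b a := by
    intro ψ hψ
    by_cases ha : ψ.r one a
    · exact ψ.iseqv.trans (ψ.iseqv.symm (hab ψ hψ ha)) ha
    · exact h.V_rel (hV hψ) hbp h1 (fun hh => ha (hba ψ hψ hh)) ha
  have hγa : γ.r one a := γ.iseqv.trans hb (hlt.le hZab)
  exact absurd (sup_le (Ctx.theta_le hγ hγa) hlt.le) (not_le_of_gt hγδ)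
end

section
/- Assume conditions (M), (O), (R), (P). Let μ ∈ Cm, U := μ/∼, and 0_U := ⋀U. Then U = {β ∈ C : 0_U ≤ β and μ⁺ covers β}; that is, the PIP class of μ consists exactly of those congruences lying above 0_U that are covered by μ⁺. (This is part 1 of Theorem 13 of the paper, describing the location of the PIP equivalence classes in the congruence lattice.) -/
variable {A : Type*}

/-- The standing hypotheses, bundled. -/
structure Hyp (one : A) (C : Set (Setoid A)) : Prop where
  hInf : ∀ S ⊆ C, sInf S ∈ C
  hSup : ∀ S ⊆ C, sSup S ∈ C
  hDir : ∀ D ⊆ C, D.Nonempty → DirectedOn (· ≤ ·) D →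
      ∀ x y : A, (sSup D).r x y ↔ ∃ s ∈ D, s.r x y
  hM : ∀ x ∈ C, ∀ y ∈ C, ∀ z ∈ C, x ≤ z → x ⊔ y ⊓ z = (x ⊔ y) ⊓ z
  hO : ∀ α ∈ C, ∀ a b : A, α ⊔ theta C one a = α ⊔ theta C one b ↔ α.r a b
  hR : ∀ α ∈ C, ∀ β ∈ C, (∀ x : A, α.r one x ↔ β.r one x) → α = β
  hP : ∀ φ ψ p q : Setoid A, IsCMI C φ p → IsCMI C ψ q →
      Projective C (φ, p) (ψ, q) → p = q

/-- prime interval -/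
def Prm (C : Set (Setoid A)) (x y : Setoid A) : Prop :=
  x ∈ C ∧ y ∈ C ∧ x < y ∧ ∀ γ ∈ C, x < γ → γ < y → False

/-- a common lower transpose -/
def Ee (C : Set (Setoid A)) (p φ ψ : Setoid A) : Prop :=
  ∃ y ∈ C, y ≤ p ∧ ¬ y ≤ φ ∧ ¬ y ≤ ψ ∧ y ⊓ φ = y ⊓ ψ

section
variable {one : A} {C : Set (Setoid A)}

theorem Prm.eq_or {x y g : Setoid A} (h : Prm C x y) (hg : g ∈ C) (h1 : x ≤ g) (h2 : g ≤ y) :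
    g = x ∨ g = y := by
  by_contra hc
  push Not at hc
  exact h.2.2.2 g hg (lt_of_le_of_ne h1 hc.1.symm) (lt_of_le_of_ne h2 hc.2)

theorem IsCMI.prm {x y : Setoid A} (h : IsCMI C x y) : Prm C x y :=
  ⟨h.1, h.2.1, h.2.2.1, fun γ hγ h1 h2 => (h.2.2.2 γ hγ h1).not_gt h2⟩

namespace Hyp

theorem sup (H : Hyp one C) {x y : Setoid A} (hx : x ∈ C) (hy : y ∈ C) : x ⊔ y ∈ C := by
  rw [← sSup_pair]
  exact H.hSup _ (by rintro s (rfl | rfl) <;> assumption)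

theorem inf (H : Hyp one C) {x y : Setoid A} (hx : x ∈ C) (hy : y ∈ C) : x ⊓ y ∈ C := by
  rw [← sInf_pair]
  exact H.hInf _ (by rintro s (rfl | rfl) <;> assumption)

theorem th (H : Hyp one C) (a b : A) : theta C a b ∈ C := H.hInf _ (fun _ h => h.1)

theorem th_mem (a b : A) : (theta C a b).r a b := by
  intro s hs
  exact hs.2

theorem th_le {a b : A} {s : Setoid A} (hs : s ∈ C) (h : s.r a b) : theta C a b ≤ s :=
  sInf_le ⟨hs, h⟩

theorem le_of (H : Hyp one C) {s t : Setoid A} (hs : s ∈ C) (ht : t ∈ C)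
    (h : ∀ x, s.r one x → t.r one x) : s ≤ t := by
  have : s ⊓ t = s := H.hR _ (H.inf hs ht) _ hs (fun x => ⟨fun hx => hx.1, fun hx => ⟨hx, h x hx⟩⟩)
  exact inf_eq_left.1 this

theorem exists_of (H : Hyp one C) {s t : Setoid A} (hs : s ∈ C) (ht : t ∈ C)
    (h : ¬ s ≤ t) : ∃ x, s.r one x ∧ ¬ t.r one x := by
  by_contra hc
  push Not at hc
  exact h (H.le_of hs ht hc)

theorem sup_eq (H : Hyp one C) {η p t : Setoid A} (h : Prm C η p) (ht : t ∈ C) (htp : t ≤ p)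
    (hn : ¬ t ≤ η) : t ⊔ η = p := by
  rcases h.eq_or (H.sup ht h.1) le_sup_right (sup_le htp h.2.2.1.le) with h1 | h1
  · exact absurd (sup_eq_right.1 h1) hn
  · exact h1

theorem two (H : Hyp one C) {η p : Setoid A} (h : Prm C η p) {x d : A} (hx : p.r one x)
    (hd : p.r one d) (nx : ¬ η.r one x) (nd : ¬ η.r one d) : η.r x d := by
  rw [← H.hO η h.1, sup_comm, sup_comm η, H.sup_eq h (H.th _ _) (th_le h.2.1 hx),
    H.sup_eq h (H.th _ _) (th_le h.2.1 hd)]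
  · exact fun hc => nd (hc (th_mem _ _))
  · exact fun hc => nx (hc (th_mem _ _))

theorem coat (H : Hyp one C) {η η' p t : Setoid A} (h : Prm C η p) (h' : Prm C η' p)
    (ht : t ∈ C) (htp : t ≤ p) (hn : ¬ t ≤ η') (hle : t ⊓ η ≤ η') : t ⊓ η = t ⊓ η' := by
  apply le_antisymm (le_inf inf_le_left hle)
  refine le_inf inf_le_left (H.le_of (H.inf ht h'.1) h.1 ?_)
  rintro x ⟨hx1, hx2⟩
  by_contra hxn
  obtain ⟨d, hd, hdn⟩ := H.exists_of ht h'.1 hn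
  by_cases hdη : η.r one d
  · exact hdn (hle ⟨hd, hdη⟩)
  · have h1 := H.two h (htp hx1) (htp hd) hxn hdη
    have h2 : η'.r x d := hle ⟨t.trans (t.symm hx1) hd, h1⟩
    exact hdn (η'.trans hx2 h2)

theorem Ee_symm {p φ ψ : Setoid A} (h : Ee C p φ ψ) : Ee C p ψ φ := by
  obtain ⟨y, h1, h2, h3, h4, h5⟩ := h
  exact ⟨y, h1, h2, h4, h3, h5.symm⟩

/-- either done or can shrink -/
theorem shrink (H : Hyp one C) {p a b c : Setoid A} (ha : Prm C a p)
    (hc : Prm C c p) (h : Ee C p a b) :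
    Ee C p a c ∨ ∃ y ∈ C, y ≤ p ∧ ¬ y ≤ a ∧ ¬ y ≤ b ∧ y ⊓ a = y ⊓ b ∧ y ≤ c := by
  obtain ⟨y, h1, h2, h3, h4, h5⟩ := h
  by_cases hy : y ⊓ c ≤ a
  · left
    have := H.coat hc ha h1 h2 h3 hy
    refine ⟨y, h1, h2, h3, fun hyc => h3 ?_, this.symm⟩
    rwa [inf_eq_left.2 hyc] at hy
  · right
    have e : (y ⊓ c) ⊓ a = (y ⊓ c) ⊓ b := by
      rw [inf_right_comm, h5, inf_right_comm]
    refine ⟨y ⊓ c, H.inf h1 hc.1, inf_le_left.trans h2, hy, fun hb => hy ?_, e, inf_le_right⟩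
    rw [inf_eq_left.2 hb] at e
    exact inf_eq_left.1 e

theorem Ee_trans (H : Hyp one C) {p a b c : Setoid A} (ha : Prm C a p) (hb : Prm C b p)
    (hc : Prm C c p) (h : Ee C p a b) (h' : Ee C p b c) : Ee C p a c := by
  rcases H.shrink ha hc h with h | ⟨y, yC, yp, ya, yb, ye, yc⟩
  · exact h
  rcases H.shrink hc ha (Ee_symm h') with h | ⟨z, zC, zp, zc, zb, ze, za⟩
  · exact Ee_symm h
  have tC := H.sup yC zC
  have tp : y ⊔ z ≤ p := sup_le yp zp
  have ta : ¬ y ⊔ z ≤ a := fun hh => ya (le_sup_left.trans hh)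
  have tc : ¬ y ⊔ z ≤ c := fun hh => zc (le_sup_right.trans hh)
  refine ⟨(y ⊔ z) ⊓ b, H.inf tC hb.1, inf_le_left.trans tp, fun hh => ?_, fun hh => ?_, ?_⟩
  · have := H.coat hb ha tC tp ta hh
    apply zb
    calc z ≤ (y ⊔ z) ⊓ a := le_inf le_sup_right za
      _ ≤ b := by rw [← this]; exact inf_le_right
  · have := H.coat hb hc tC tp tc hh
    apply yb
    calc y ≤ (y ⊔ z) ⊓ c := le_inf le_sup_left yc
      _ ≤ b := by rw [← this]; exact inf_le_right
  · have e1 : (y ⊔ z) ⊓ b ⊓ a = y ⊓ b ⊔ z ⊓ b := by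
      rw [inf_right_comm, sup_comm y z, ← H.hM z zC y yC a ha.1 za, ye, sup_comm z,
        H.hM _ (H.inf yC hb.1) z zC b hb.1 inf_le_right]
    have e2 : (y ⊔ z) ⊓ b ⊓ c = y ⊓ b ⊔ z ⊓ b := by
      rw [inf_right_comm, ← H.hM y yC z zC c hc.1 yc, ze, sup_comm y,
        sup_comm (y ⊓ b), H.hM _ (H.inf zC hb.1) y yC b hb.1 inf_le_right]
    rw [e1, e2]

theorem exists_cmi (H : Hyp one C) {x y : Setoid A} (h : Prm C x y) :
    ∃ η q, IsCMI C η q ∧ x = y ⊓ η ∧ q = y ⊔ η := by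
  obtain ⟨a, hay, hax⟩ := H.exists_of h.2.1 h.1 h.2.2.1.not_ge
  obtain ⟨η, hxη, hη⟩ := zorn_le_nonempty₀ {s | s ∈ C ∧ ¬ s.r one a} (by
    intro D hD hch s hs
    refine ⟨sSup D, ⟨H.hSup _ (fun t ht => (hD ht).1), ?_⟩, fun z hz => le_sSup hz⟩
    rw [H.hDir D (fun t ht => (hD ht).1) ⟨s, hs⟩ hch.directedOn]
    rintro ⟨t, ht, hta⟩
    exact (hD ht).2 hta) x ⟨h.1, hax⟩
  have ηC : η ∈ C := hη.prop.1
  have ηa : ¬ η.r one a := hη.prop.2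
  have key : ∀ β ∈ C, η < β → y ≤ β := by
    intro β hβ hlt
    have hβa : β.r one a := by
      by_contra hc
      exact hlt.not_ge (hη.le_of_ge ⟨hβ, hc⟩ hlt.le)
    have : theta C one a ⊔ x = y := H.sup_eq h (H.th _ _) (th_le h.2.1 hay)
      (fun hc => hax (hc (th_mem _ _)))
    rw [← this]
    exact sup_le (th_le hβ hβa) (hxη.trans hlt.le)
  refine ⟨η, y ⊔ η, ⟨ηC, H.sup h.2.1 ηC, ?_, fun β hβ hlt => sup_le (key β hβ hlt) hlt.le⟩, ?_, rfl⟩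
  · refine lt_of_le_of_ne le_sup_right fun hc => ηa ?_
    have : y ≤ η := sup_eq_right.1 hc.symm
    exact this hay
  · rcases h.eq_or (H.inf h.2.1 ηC) (le_inf h.2.2.1.le hxη) inf_le_left with h1 | h1
    · exact h1.symm
    · exact absurd (inf_eq_left.1 h1 hay) ηa

theorem prm_up (H : Hyp one C) {x y z w : Setoid A} (h : Prm C x y) (zC : z ∈ C) (wC : w ∈ C)
    (h1 : x = y ⊓ z) (h2 : w = y ⊔ z) : Prm C z w := by
  refine ⟨zC, wC, ?_, fun g gC hzg hgw => ?_⟩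
  · refine lt_of_le_of_ne (h2 ▸ le_sup_right) fun hc => ?_
    have : y ≤ z := by rw [hc, h2]; exact le_sup_left
    rw [inf_eq_left.2 this] at h1
    exact h.2.2.1.ne h1
  · rcases h.eq_or (H.inf h.2.1 gC) (h1 ▸ inf_le_inf_left y hzg.le) inf_le_left with e | e
    · have := H.hM z zC y h.2.1 g gC hzg.le
      rw [e, sup_comm z y, ← h2, inf_eq_right.2 hgw.le, h1, sup_eq_left.2 inf_le_right] at this
      exact hzg.ne this
    · refine hgw.not_ge ?_
      rw [h2]
      exact sup_le (inf_eq_left.1 e) hzg.le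

theorem prm_down (H : Hyp one C) {x y z w : Setoid A} (h : Prm C x y) (zC : z ∈ C) (wC : w ∈ C)
    (h1 : z = w ⊓ x) (h2 : y = w ⊔ x) : Prm C z w := by
  refine ⟨zC, wC, ?_, fun g gC hzg hgw => ?_⟩
  · refine lt_of_le_of_ne (h1 ▸ inf_le_left) fun hc => ?_
    have : w ≤ x := by rw [← hc, h1]; exact inf_le_right
    rw [sup_eq_right.2 this] at h2
    exact h.2.2.1.ne h2.symm
  · rcases h.eq_or (H.sup gC h.1) le_sup_right (h2 ▸ sup_le_sup_right hgw.le x) with e | e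
    · refine hzg.not_ge ?_
      rw [h1]
      exact le_inf hgw.le (sup_eq_right.1 e)
    · have := H.hM g gC x h.1 w wC hgw.le
      have hwy : w ≤ y := h2 ▸ le_sup_left
      rw [e, inf_eq_right.2 hwy, inf_comm, ← h1, sup_eq_left.2 hzg.le] at this
      exact hgw.ne this

theorem up_trans {x y z w η q : Setoid A} (h1 : x = y ⊓ z) (h2 : w = y ⊔ z)
    (h3 : z = w ⊓ η) (h4 : q = w ⊔ η) : x = y ⊓ η ∧ q = y ⊔ η := by
  constructor
  · have hyw : y ≤ w := h2 ▸ le_sup_left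
    rw [h1, h3, ← inf_assoc, inf_eq_left.2 hyw]
  · have hz : z ≤ η := h3 ▸ inf_le_right
    rw [h4, h2, sup_assoc, sup_eq_right.2 hz]

theorem chain (H : Hyp one C) {φ p : Setoid A} (hφ : IsCMI C φ p) {J : Setoid A × Setoid A}
    (h : Projective C (φ, p) J) : Prm C J.1 J.2 ∧
      ∀ η q, IsCMI C η q → J.1 = J.2 ⊓ η → q = J.2 ⊔ η → q = p ∧ Ee C p φ η := by
  induction h with
  | refl =>
    refine ⟨hφ.prm, fun η q hη h1 h2 => ?_⟩
    dsimp only at h1 h2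
    have hq : p = q := H.hP φ η p q hφ hη
      (.single ⟨hφ.1, hφ.2.1, hη.1, hη.2.1, .inl ⟨h1, h2⟩⟩)
    subst hq
    have : φ = η := by rw [h1]; exact inf_eq_right.2 hη.2.2.1.le
    subst this
    exact ⟨rfl, p, hφ.2.1, le_rfl, hφ.2.2.1.not_ge, hφ.2.2.1.not_ge, rfl⟩
  | @tail I J hI hIJ ih =>
    obtain ⟨hpr, hall⟩ := ih
    have hIJ' := hIJ
    obtain ⟨xC, yC, zC, wC, ⟨h1, h2⟩ | ⟨h1, h2⟩⟩ := hIJ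
    · refine ⟨H.prm_up hpr zC wC h1 h2, fun η q hη h3 h4 => ?_⟩
      obtain ⟨h5, h6⟩ := up_trans h1 h2 h3 h4
      exact hall η q hη h5 h6
    · refine ⟨H.prm_down hpr zC wC h1 h2, fun η q hη h3 h4 => ?_⟩
      have hq : p = q := H.hP φ η p q hφ hη
        ((hI.tail hIJ').tail ⟨zC, wC, hη.1, hη.2.1, .inl ⟨h3, h4⟩⟩)
      subst hq
      obtain ⟨η', q', hη', h5, h6⟩ := H.exists_cmi hpr
      obtain ⟨rfl, hE⟩ := hall η' q' hη' h5 h6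
      obtain ⟨h7, h8⟩ := up_trans h1 h2 h5 h6
      refine ⟨rfl, H.Ee_trans hφ.prm hη'.prm hη.prm hE
        ⟨J.2, wC, h8 ▸ le_sup_left, fun hc => ?_, fun hc => ?_, h7.symm.trans h3⟩⟩
      · rw [sup_eq_right.2 hc] at h8
        exact hη'.2.2.1.ne h8.symm
      · rw [sup_eq_right.2 hc] at h4
        exact hη.2.2.1.ne h4.symm

theorem persp_symm {I J : Setoid A × Setoid A} (h : Persp C I J) : Persp C J I := by
  obtain ⟨h1, h2, h3, h4, h5⟩ := h
  exact ⟨h3, h4, h1, h2, h5.symm⟩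

theorem cmi_unique {η p q : Setoid A} (h : IsCMI C η p) (h' : IsCMI C η q) : p = q :=
  le_antisymm (h.2.2.2 q h'.2.1 h'.2.2.1) (h'.2.2.2 p h.2.1 h.2.2.1)

theorem pip (H : Hyp one C) {μ p ψ : Setoid A} (hμ : IsCMI C μ p) (h : PIP C ψ μ) :
    IsCMI C ψ p ∧ Projective C (ψ, p) (μ, p) ∧ Ee C p ψ μ := by
  obtain ⟨r, q, hψ, hq, hpr⟩ := h
  obtain rfl := cmi_unique hμ hq
  obtain rfl := H.hP _ _ _ _ hψ hμ hpr
  refine ⟨hψ, hpr, ((H.chain hψ hpr).2 μ r hμ ?_ ?_).2⟩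
  · exact (inf_eq_right.2 hμ.2.2.1.le).symm
  · exact (sup_eq_left.2 hμ.2.2.1.le).symm

theorem main (H : Hyp one C) {μ p β : Setoid A} (hμ : IsCMI C μ p) (hβ : Prm C β p)
    (hle : sInf {ψ | PIP C ψ μ} ≤ β) : PIP C β μ := by
  obtain ⟨a, hap, haβ⟩ := H.exists_of hβ.2.1 hβ.1 hβ.2.2.1.not_ge
  have hZ : ∃ Z, Z = sInf {ψ | PIP C ψ μ} := ⟨_, rfl⟩
  obtain ⟨Z, hZ⟩ := hZ
  rw [← hZ] at hle
  have ZC : Z ∈ C := by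
    rw [hZ]
    exact H.hInf _ fun ψ hψ => (H.pip hμ hψ).1.1
  have Zle : ∀ ψ, PIP C ψ μ → Z ≤ ψ := fun ψ hψ => hZ ▸ sInf_le hψ
  have : ∃ φ, PIP C φ μ ∧ ¬ φ.r one a := by
    by_contra hc
    push Not at hc
    apply haβ
    apply hle
    rw [hZ]
    intro s hs
    exact hc s hs
  obtain ⟨φ, hφU, hφa⟩ := this
  obtain ⟨hφ, hφpr, hφE⟩ := H.pip hμ hφU
  have hT : ∃ t, t = Z ⊔ theta C one a := ⟨_, rfl⟩
  obtain ⟨t, ht⟩ := hT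
  have tC : t ∈ C := ht ▸ H.sup ZC (H.th _ _)
  have Zt : Z ≤ t := ht ▸ le_sup_left
  have ta : t.r one a := by
    have : theta C one a ≤ t := ht ▸ le_sup_right
    exact this (th_mem _ _)
  have tle : ∀ s ∈ C, Z ≤ s → s.r one a → t ≤ s := fun s hs h1 h2 => ht ▸ sup_le h1 (th_le hs h2)
  have tp : t ≤ p := tle p hμ.2.1 ((Zle φ hφU).trans hφ.2.2.1.le) hap
  have tφ : t ⊓ φ = Z := by
    apply le_antisymm _ (le_inf Zt (Zle φ hφU))
    apply H.le_of (H.inf tC hφ.1) ZC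
    rintro b ⟨hbt, hbφ⟩
    rw [hZ]
    intro ψ hψU
    by_contra hbψ
    obtain ⟨hψ, -, hψE⟩ := H.pip hμ hψU
    obtain ⟨y, yC, yp, yφ, yψ, ye⟩ := H.Ee_trans hφ.prm hμ.prm hψ.prm hφE (Ee_symm hψE)
    have haψ : ¬ ψ.r one a := fun hc => hbψ (tle ψ hψ.1 (Zle ψ hψU) hc hbt)
    obtain ⟨d, hdy, hdφ⟩ := H.exists_of yC hφ.1 yφ
    have hdψ : ¬ ψ.r one d := fun hc => hdφ (by
      have h0 : (y ⊓ ψ).r one d := ⟨hdy, hc⟩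
      rw [← ye] at h0
      exact h0.2)
    have h1 : (φ ⊓ ψ).r d a := ⟨H.two hφ.prm (yp hdy) hap hdφ hφa,
      H.two hψ.prm (yp hdy) hap hdψ haψ⟩
    have gC := H.inf hφ.1 hψ.1
    have hda : (φ ⊓ ψ ⊔ y).r one a :=
      Setoid.trans' _ ((le_sup_right : y ≤ φ ⊓ ψ ⊔ y) hdy)
        ((le_sup_left : φ ⊓ ψ ≤ φ ⊓ ψ ⊔ y) h1)
    have htd := tle _ (H.sup gC yC) ((le_inf (Zle φ hφU) (Zle ψ hψU)).trans le_sup_left) hda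
    have hm := H.hM _ gC y yC φ hφ.1 inf_le_left
    have hb : ((φ ⊓ ψ ⊔ y) ⊓ φ).r one b := ⟨htd hbt, hbφ⟩
    rw [← hm, sup_eq_left.2 (le_inf inf_le_right (ye ▸ inf_le_right))] at hb
    exact hbψ hb.2
  have tnβ : ¬ t ≤ β := fun hc => haβ (hc ta)
  have tnφ : ¬ t ≤ φ := fun hc => hφa (hc ta)
  have tβ : t ⊓ φ = t ⊓ β := H.coat hφ.prm hβ tC tp tnβ (tφ ▸ hle)
  have P1 : Persp C (Z, t) (φ, p) := ⟨ZC, tC, hφ.1, hφ.2.1,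
    .inl ⟨tφ.symm, (H.sup_eq hφ.prm tC tp tnφ).symm⟩⟩
  have P2 : Persp C (Z, t) (β, p) := ⟨ZC, tC, hβ.1, hβ.2.1,
    .inl ⟨tφ.symm.trans tβ, (H.sup_eq hβ tC tp tnβ).symm⟩⟩
  obtain ⟨η, q, hη, h1, h2⟩ := H.exists_cmi hβ
  have P3 : Persp C (β, p) (η, q) := ⟨hβ.1, hβ.2.1, hη.1, hη.2.1, .inl ⟨h1, h2⟩⟩
  have hq : p = q := H.hP φ η p q hφ hη (((Relation.ReflTransGen.single (persp_symm P1)).tail P2).tail P3)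
  subst hq
  rw [inf_eq_right.2 hη.2.2.1.le] at h1
  subst h1
  exact ⟨p, p, hη, hμ, .head (persp_symm P2) (.head P1 hφpr)⟩

end Hyp
end

/-- Theorem 13, part 1: the PIP class `U = μ/∼` consists exactly of those members of
`C` lying above `0_U = ⋀U` that are covered (in `C`) by `μ⁺ = p`. -/
theorem stmt10 (one : A) (C : Set (Setoid A))
    (hInf : ∀ S ⊆ C, sInf S ∈ C) (hSup : ∀ S ⊆ C, sSup S ∈ C)
    (hDir : ∀ D ⊆ C, D.Nonempty → DirectedOn (· ≤ ·) D →
      ∀ x y : A, (sSup D).r x y ↔ ∃ s ∈ D, s.r x y)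
    (hM : ∀ x ∈ C, ∀ y ∈ C, ∀ z ∈ C, x ≤ z → x ⊔ y ⊓ z = (x ⊔ y) ⊓ z)
    (hO : ∀ α ∈ C, ∀ a b : A, α ⊔ theta C one a = α ⊔ theta C one b ↔ α.r a b)
    (hR : ∀ α ∈ C, ∀ β ∈ C, (∀ x : A, α.r one x ↔ β.r one x) → α = β)
    (hP : ∀ φ ψ p q : Setoid A, IsCMI C φ p → IsCMI C ψ q →
      Projective C (φ, p) (ψ, q) → p = q)
    (μ p : Setoid A) (hμ : IsCMI C μ p) :
    {ψ | PIP C ψ μ} =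
      {β | β ∈ C ∧ sInf {ψ | PIP C ψ μ} ≤ β ∧ β < p ∧
        ∀ γ ∈ C, β < γ → γ < p → False} := by
  have H : Hyp one C := ⟨hInf, hSup, hDir, hM, hO, hR, hP⟩
  ext β
  constructor
  · intro h
    have h1 := (H.pip hμ h).1
    exact ⟨h1.1, sInf_le h, h1.prm.2.2⟩
  · rintro ⟨h1, h2, h3⟩
    exact H.main hμ ⟨h1, hμ.2.1, h3⟩ h2
end

section
/- Assume that A is finite, conditions (M), (O), (R), (P), (D) hold, and there is a binary operation e : A × A → A with Θ(a,b) = Θ(1, e(a,b)) for all a, b ∈ A (a principal congruence term). Then the map a ↦ M(a) := {μ ∈ Cm : (1,a) ∈ μ} is a bijection from A onto the family ℋ of hereditary subsets of Cm, and it satisfies M(e(a,b)) = M(a) ↔ M(b) for all a, b ∈ A; hence (A, e) is isomorphic to (ℋ, ↔). (This is part 2 of Theorem 24, the main representation theorem of the paper, for finite congruence orderable algebras with a Malcev term.) -/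
variable {A : Type*}

/-- The set of completely meet irreducible members of `C`. -/
def CmSet (C : Set (Setoid A)) : Set (Setoid A) := {μ | ∃ p, IsCMI C μ p}

/-- `M(a) = {μ ∈ Cm : (1,a) ∈ μ}`. -/
def MsetA (C : Set (Setoid A)) (one a : A) : Set (Setoid A) :=
  {μ | μ ∈ CmSet C ∧ μ.r one a}

/-- The downward closure `X↓` of `X` inside the poset `Cm`. -/
def DownCl (C : Set (Setoid A)) (X : Set (Setoid A)) : Set (Setoid A) :=
  {μ | μ ∈ CmSet C ∧ ∃ φ ∈ X, μ ≤ φ}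

/-- The equivalence operation `S ↔ T := Cm \ ((S Δ T)↓)` of the Heyting algebra of
upward closed subsets of `Cm`. -/
def EqOpU (C : Set (Setoid A)) (S T : Set (Setoid A)) : Set (Setoid A) :=
  CmSet C \ DownCl C ((S \ T) ∪ (T \ S))

/-- `H` is a subgroup of the Boolean group `(Ū, •)`, where `U` is the PIP class of `η`
and `η⁺ = p`: `H` is a subset of `Ū = U ∪ {p}` containing the unit `p` and closed
under `•`. -/
def SubgrpU (C : Set (Setoid A)) (η p : Setoid A) (H : Set (Setoid A)) : Prop :=
  H ⊆ {φ | PIP C φ η} ∪ {p} ∧ p ∈ H ∧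
    ∀ φ ∈ H, ∀ ψ ∈ H, ∃ σ ∈ H, σ.r = Bul p φ ψ

/-- `H` is a hyperplane (maximal proper subgroup) of the Boolean group `(Ū, •)`. -/
def IsHyperplaneU (C : Set (Setoid A)) (η p : Setoid A) (H : Set (Setoid A)) : Prop :=
  SubgrpU C η p H ∧ H ≠ {φ | PIP C φ η} ∪ {p} ∧
    ∀ K, SubgrpU C η p K → H ⊆ K → K = H ∨ K = {φ | PIP C φ η} ∪ {p}

/-- `Z ⊆ Cm` is hereditary: it is upward closed in `Cm`, and for every PIP class `U`
with `U⁺ ⊆ Z`, the set `(Z ∩ U) ∪ {η⁺}` is either all of `Ū` or a hyperplane of the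
Boolean group `(Ū, •)`. -/
def Hered (C : Set (Setoid A)) (Z : Set (Setoid A)) : Prop :=
  (∀ μ ∈ Z, ∃ p, IsCMI C μ p) ∧
  (∀ μ ∈ Z, ∀ ν p, IsCMI C ν p → μ ≤ ν → ν ∈ Z) ∧
  ∀ η p, IsCMI C η p → {θ | (∃ q, IsCMI C θ q) ∧ η < θ} ⊆ Z →
    (Z ∩ {φ | PIP C φ η} ∪ {p} = {φ | PIP C φ η} ∪ {p} ∨
      IsHyperplaneU C η p (Z ∩ {φ | PIP C φ η} ∪ {p}))


/-- The hypotheses used, bundled. -/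
structure HypS (one : A) (C : Set (Setoid A)) : Prop where
  inf : ∀ S ⊆ C, sInf S ∈ C
  sup : ∀ S ⊆ C, sSup S ∈ C
  M : ∀ x ∈ C, ∀ y ∈ C, ∀ z ∈ C, x ≤ z → x ⊔ y ⊓ z = (x ⊔ y) ⊓ z
  O : ∀ α ∈ C, ∀ a b : A, α ⊔ theta C one a = α ⊔ theta C one b ↔ α.r a b
  R : ∀ α ∈ C, ∀ β ∈ C, (∀ x : A, α.r one x ↔ β.r one x) → α = β
  P : ∀ φ ψ p q : Setoid A, IsCMI C φ p → IsCMI C ψ q →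
      Projective C (φ, p) (ψ, q) → p = q
  D : ∀ α ∈ C, ∀ β ∈ C, ∀ η p, IsCMI C η p → α ⊓ β ≤ η →
      ∃ μ₁ μ₂ : Setoid A, (μ₁ = ⊤ ∨ PIP C μ₁ η) ∧ (μ₂ = ⊤ ∨ PIP C μ₂ η) ∧
        α ≤ μ₁ ∧ β ≤ μ₂ ∧ μ₁ ⊓ μ₂ ≤ η

/-- Direct link between two members with the same cover. -/
def Linked (C : Set (Setoid A)) (p φ ψ : Setoid A) : Prop :=
  ∃ κ ∈ C, κ ≤ p ∧ ¬ κ ≤ φ ∧ ∀ x y, κ.r x y → (φ.r x y ↔ ψ.r x y)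

section
variable {one : A} {C : Set (Setoid A)}

theorem inf_r (r s : Setoid A) (x y : A) : (r ⊓ s).r x y ↔ r.r x y ∧ s.r x y := Iff.rfl

theorem eq_of_r {r s : Setoid A} (h : r.r = s.r) : r = s := by
  cases r; cases s; cases h; rfl

theorem HypS.inf_mem (h : HypS one C) {a b : Setoid A} (ha : a ∈ C) (hb : b ∈ C) : a ⊓ b ∈ C := by
  rw [← sInf_pair]; apply h.inf; rintro x (rfl | rfl) <;> assumption

theorem HypS.sup_mem (h : HypS one C) {a b : Setoid A} (ha : a ∈ C) (hb : b ∈ C) : a ⊔ b ∈ C := by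
  rw [← sSup_pair]; apply h.sup; rintro x (rfl | rfl) <;> assumption

theorem HypS.bot_mem (h : HypS one C) : (⊥ : Setoid A) ∈ C := by
  rw [← sSup_empty]; exact h.sup _ (Set.empty_subset _)

theorem HypS.theta_mem (h : HypS one C) (a b : A) : theta C a b ∈ C :=
  h.inf _ (fun _ hs => hs.1)

theorem theta_rel (a b : A) : (theta C a b).r a b := by
  intro s hs; exact hs.2

theorem theta_le {a b : A} {s : Setoid A} (hs : s ∈ C) : theta C a b ≤ s ↔ s.r a b := by
  constructor
  · intro h; exact h (theta_rel a b)
  · intro h; exact sInf_le ⟨hs, h⟩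

theorem cmi_unique {η p q : Setoid A} (h1 : IsCMI C η p) (h2 : IsCMI C η q) : p = q :=
  le_antisymm (h1.2.2.2 q h2.2.1 h2.2.2.1) (h2.2.2.2 p h1.2.1 h1.2.2.1)

theorem cmi_eq {φ ψ p : Setoid A} (h1 : IsCMI C φ p) (h2 : IsCMI C ψ p) (h : φ ≤ ψ) : φ = ψ := by
  by_contra hne
  exact absurd (h1.2.2.2 ψ h2.1 (lt_of_le_of_ne h hne)) (not_le_of_gt h2.2.2.1)

theorem HypS.cmi_sup (h : HypS one C) {φ p κ : Setoid A} (h1 : IsCMI C φ p) (hk : κ ∈ C)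
    (hkp : κ ≤ p) (hn : ¬ κ ≤ φ) : κ ⊔ φ = p := by
  apply le_antisymm (sup_le hkp h1.2.2.1.le)
  apply h1.2.2.2 _ (h.sup_mem hk h1.1)
  exact lt_of_le_of_ne le_sup_right (fun e => hn (e ▸ le_sup_left))

theorem HypS.exists_max [Finite A] (h : HypS one C) {α s : Setoid A} (ha : α ∈ C) (hs : s ∈ C)
    (hn : ¬ s ≤ α) : ∃ χ, α ≤ χ ∧ ¬ s ≤ χ ∧ IsCMI C χ (χ ⊔ s) := by
  have hfin : ({β | β ∈ C ∧ α ≤ β ∧ ¬ s ≤ β} : Set (Setoid A)).Finite := by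
    have : Finite (Setoid A) := Finite.of_injective (fun r : Setoid A => r.r)
      (fun _ _ h => eq_of_r h)
    exact Set.toFinite _
  obtain ⟨χ, hχ⟩ := hfin.exists_maximal ⟨α, ha, le_rfl, hn⟩
  refine ⟨χ, hχ.prop.2.1, hχ.prop.2.2, hχ.prop.1, h.sup_mem hχ.prop.1 hs, ?_, ?_⟩
  · exact lt_of_le_of_ne le_sup_left (fun e => hχ.prop.2.2 (e ▸ le_sup_right))
  · intro β hβ hlt
    refine sup_le hlt.le ?_
    by_contra hsb
    exact absurd (hχ.le_of_ge ⟨hβ, hχ.prop.2.1.trans hlt.le, hsb⟩ hlt.le) (not_le_of_gt hlt)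

theorem HypS.exists_sep [Finite A] (h : HypS one C) {α : Setoid A} (ha : α ∈ C) {x y : A}
    (hn : ¬ α.r x y) : ∃ χ, α ≤ χ ∧ ¬ χ.r x y ∧ χ ∈ CmSet C := by
  obtain ⟨χ, h1, h2, h3⟩ := h.exists_max ha (h.theta_mem x y) (fun hh => hn ((theta_le ha).1 hh))
  exact ⟨χ, h1, fun hh => h2 ((theta_le h3.1).2 hh), _, h3⟩

theorem HypS.le_or (h : HypS one C) {φ p : Setoid A} (h1 : IsCMI C φ p) (x : A) :
    φ.r one x ∨ φ ⊔ theta C one x = p ⊔ theta C one x := by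
  by_cases hx : φ.r one x
  · exact Or.inl hx
  · right
    apply le_antisymm (sup_le_sup_right h1.2.2.1.le _)
    refine sup_le ?_ le_sup_right
    apply h1.2.2.2 _ (h.sup_mem h1.1 (h.theta_mem _ _))
    refine lt_of_le_of_ne le_sup_left (fun e => hx ?_)
    rw [← theta_le h1.1, e]
    exact le_sup_right

theorem HypS.one_or (h : HypS one C) {φ p : Setoid A} (h1 : IsCMI C φ p) {x y : A}
    (hp : p.r x y) : φ.r x y ∨ φ.r one x ∨ φ.r one y := by
  rcases h.le_or h1 x with hx | hx
  · exact Or.inr (Or.inl hx)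
  rcases h.le_or h1 y with hy | hy
  · exact Or.inr (Or.inr hy)
  left
  rw [← h.O _ h1.1, hx, hy, h.O _ h1.2.1]
  exact hp

theorem HypS.two (h : HypS one C) {φ p : Setoid A} (h1 : IsCMI C φ p) {x y z : A}
    (hp : p.r x y) (hq : p.r y z) : φ.r x y ∨ φ.r y z ∨ φ.r x z := by
  have a := h.one_or h1 hp
  have b := h.one_or h1 hq
  have c := h.one_or h1 (p.trans hp hq)
  have t : ∀ {u v}, φ.r one u → φ.r one v → φ.r u v := fun hu hv => φ.trans (φ.symm hu) hv
  rcases a with a | a | a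
  · exact Or.inl a
  · rcases b with b | b | b
    · exact Or.inr (Or.inl b)
    · exact Or.inl (t a b)
    · exact Or.inr (Or.inr (t a b))
  · rcases c with c | c | c
    · exact Or.inr (Or.inr c)
    · exact Or.inl (t c a)
    · exact Or.inr (Or.inl (t a c))

theorem HypS.one_cl (h : HypS one C) {φ p : Setoid A} (h1 : IsCMI C φ p) {x y : A}
    (hp : p.r x y) (hn : ¬ φ.r x y) : p.r one x := by
  rcases h.one_or h1 hp with a | a | a
  · exact absurd a hn
  · exact h1.2.2.1.le a
  · exact p.trans (h1.2.2.1.le a) (p.symm hp)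

theorem HypS.prime_tr (h : HypS one C) {χ p s x : Setoid A} (h1 : IsCMI C χ p) (hs : s ∈ C)
    (hsp : s ≤ p) (hx : x ∈ C) (hl : s ⊓ χ ≤ x) (hu : x ≤ s) : x ≤ χ ∨ x = s := by
  by_cases hn : x ≤ χ
  · exact Or.inl hn
  right
  have e1 := h.cmi_sup h1 hx (hu.trans hsp) hn
  have e2 := h.M x hx χ h1.1 s hs hu
  rw [e1, inf_eq_right.2 hsp, inf_comm, sup_eq_left.2 hl] at e2
  exact e2

theorem HypS.swap (h : HypS one C) {φ ψ χ p : Setoid A} (h1 : IsCMI C φ p) (h2 : IsCMI C ψ p)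
    (h3 : IsCMI C χ p) (hl : φ ⊓ ψ ≤ χ) (hne : ψ ≠ χ) : ψ ⊓ χ ≤ φ := by
  rcases h.prime_tr h1 h2.1 h2.2.2.1.le (h.inf_mem h2.1 h3.1) (x := ψ ⊓ χ)
    (le_inf inf_le_left (by rw [inf_comm]; exact hl)) inf_le_left with a | a
  · exact a
  · exact absurd (cmi_eq h2 h3 (a ▸ inf_le_right)) hne

theorem third_aux {P : A → Prop} {φ ψ χ : Setoid A}
    (t1 : ∀ x y z, P x → P y → P z → φ.r x y ∨ φ.r y z ∨ φ.r x z)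
    (t2 : ∀ x y z, P x → P y → P z → ψ.r x y ∨ ψ.r y z ∨ ψ.r x z)
    (t3 : ∀ x y z, P x → P y → P z → χ.r x y ∨ χ.r y z ∨ χ.r x z)
    (h12 : ∀ x y, φ.r x y → ψ.r x y → χ.r x y)
    (h13 : ∀ x y, χ.r x y → (φ.r x y ↔ ψ.r x y))
    {x y u v : A} (hx : P x) (hy : P y) (hu : P u) (hv : P v)
    (c : χ.r u v) (f : ¬ φ.r u v) (nf : ¬ φ.r x y) (ns : ¬ ψ.r x y) : χ.r x y := by
  have g : ¬ ψ.r u v := fun hh => f ((h13 _ _ c).2 hh)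
  -- the core case
  have core : ∀ x y u v, P x → P y → P u → P v → χ.r u v → ¬ φ.r u v → ¬ ψ.r u v →
      ¬ φ.r x y → ¬ ψ.r x y → χ.r x u → φ.r x u → χ.r x y := by
    intro x y u v hx hy hu hv c f g nf ns cxu fxu
    have sxu := (h13 _ _ cxu).1 fxu
    have fyv : φ.r y v := by
      rcases t1 y u v hy hu hv with a | a | a
      · exact absurd (φ.trans fxu (φ.symm a)) nf
      · exact absurd a f
      · exact a
    have syv : ψ.r y v := by
      rcases t2 y u v hy hu hv with a | a | a
      · exact absurd (ψ.trans sxu (ψ.symm a)) ns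
      · exact absurd a g
      · exact a
    exact χ.trans cxu (χ.trans c (χ.symm (h12 _ _ fyv syv)))
  have core2 : ∀ x y u v, P x → P y → P u → P v → χ.r u v → ¬ φ.r u v → ¬ ψ.r u v →
      ¬ φ.r x y → ¬ ψ.r x y → χ.r x u → χ.r x y := by
    intro x y u v hx hy hu hv c f g nf ns cxu
    rcases t1 x u v hx hu hv with a | a | a
    · exact core x y u v hx hy hu hv c f g nf ns cxu a
    · exact absurd a f
    · exact core x y v u hx hy hv hu (χ.symm c) (fun k => f (φ.symm k)) (fun k => g (ψ.symm k))
        nf ns (χ.trans cxu c) a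
  rcases t3 x y u hx hy hu with a | a | a
  · exact a
  · exact χ.symm (core2 y x u v hy hx hu hv c f g (fun k => nf (φ.symm k))
      (fun k => ns (ψ.symm k)) a)
  · exact core2 x y u v hx hy hu hv c f g nf ns a

theorem HypS.third (h : HypS one C) {φ ψ χ p : Setoid A} (h1 : IsCMI C φ p) (h2 : IsCMI C ψ p)
    (h3 : IsCMI C χ p) (h12 : φ ⊓ ψ ≤ χ) (h31 : χ ⊓ φ ≤ ψ) (h32 : χ ⊓ ψ ≤ φ)
    (hne : ¬ χ ≤ φ) : χ.r = Bul p φ ψ := by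
  have h13 : ∀ x y, χ.r x y → (φ.r x y ↔ ψ.r x y) := fun x y hc =>
    ⟨fun k => h31 (show (χ ⊓ φ).r x y from ⟨hc, k⟩), fun k => h32 (show (χ ⊓ ψ).r x y from ⟨hc, k⟩)⟩
  funext x y
  apply propext
  constructor
  · exact fun hc => ⟨h3.2.2.1.le hc, h13 x y hc⟩
  · rintro ⟨hp, hiff⟩
    by_cases f : φ.r x y
    · exact h12 (show (φ ⊓ ψ).r x y from ⟨f, hiff.1 f⟩)
    · have : ∃ u v, χ.r u v ∧ ¬ φ.r u v := by
        by_contra hcon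
        push Not at hcon
        exact hne (fun u v k => hcon u v k)
      obtain ⟨u, v, c, fuv⟩ := this
      have T : ∀ {θ : Setoid A}, IsCMI C θ p → ∀ x y z, p.r one x → p.r one y → p.r one z →
          θ.r x y ∨ θ.r y z ∨ θ.r x z := fun hθ x y z hx hy hz =>
        h.two hθ (p.trans (p.symm hx) hy) (p.trans (p.symm hy) hz)
      have px := h.one_cl h1 hp f
      have pu := h.one_cl h1 (h3.2.2.1.le c) fuv
      exact third_aux (P := fun z => p.r one z) (T h1) (T h2) (T h3)
        (fun x y a b => h12 (show (φ ⊓ ψ).r x y from ⟨a, b⟩)) h13 px (p.trans px hp) pu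
        (p.trans pu (h3.2.2.1.le c)) c fuv f (fun k => f (hiff.2 k))

theorem HypS.linked_proj (h : HypS one C) {φ ψ p : Setoid A} (h1 : IsCMI C φ p)
    (h2 : IsCMI C ψ p) (hl : Linked C p φ ψ) : Projective C (φ, p) (ψ, p) := by
  obtain ⟨κ, hk, hkp, hn, hb⟩ := hl
  have hn2 : ¬ κ ≤ ψ := fun hh => hn (fun x y k => (hb x y k).2 (hh k))
  have e : κ ⊓ φ = κ ⊓ ψ := by
    apply eq_of_r; funext x y; apply propext
    rw [inf_r, inf_r]
    exact ⟨fun k => ⟨k.1, (hb x y k.1).1 k.2⟩, fun k => ⟨k.1, (hb x y k.1).2 k.2⟩⟩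
  refine (Relation.ReflTransGen.single (b := (κ ⊓ φ, κ)) ?_).tail ?_
  · exact ⟨h1.1, h1.2.1, h.inf_mem hk h1.1, hk, Or.inr ⟨rfl, (h.cmi_sup h1 hk hkp hn).symm⟩⟩
  · exact ⟨h.inf_mem hk h1.1, hk, h2.1, h2.2.1, Or.inl ⟨e, (h.cmi_sup h2 hk hkp hn2).symm⟩⟩

theorem linked_symm {φ ψ p : Setoid A} (hl : Linked C p φ ψ) : Linked C p ψ φ := by
  obtain ⟨κ, hk, hkp, hn, hb⟩ := hl
  exact ⟨κ, hk, hkp, fun hh => hn (fun x y k => (hb x y k).2 (hh k)), fun x y k => (hb x y k).symm⟩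

theorem linked_refl {φ p : Setoid A} (h1 : IsCMI C φ p) : Linked C p φ φ :=
  ⟨p, h1.2.1, le_rfl, not_le_of_gt h1.2.2.1, fun _ _ _ => Iff.rfl⟩

theorem HypS.third_exists [Finite A] (h : HypS one C) {φ ψ p : Setoid A} (h1 : IsCMI C φ p)
    (h2 : IsCMI C ψ p) (hne : φ ≠ ψ) (hl : Linked C p φ ψ) :
    ∃ σ, IsCMI C σ p ∧ σ.r = Bul p φ ψ := by
  obtain ⟨κ, hk, hkp, hn, hb⟩ := hl
  have hn2 : ¬ κ ≤ ψ := fun hh => hn (fun x y k => (hb x y k).2 (hh k))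
  have s1 := h.cmi_sup h1 hk hkp hn
  have s2 := h.cmi_sup h2 hk hkp hn2
  have hdC := h.inf_mem h1.1 h2.1
  have hnp : ¬ p ≤ κ ⊔ (φ ⊓ ψ) := by
    intro hp
    have hM := h.M (φ ⊓ ψ) hdC κ hk φ h1.1 inf_le_left
    have e1 : φ ⊓ ψ ⊔ κ ⊓ φ ≤ ψ := by
      refine sup_le inf_le_right ?_
      intro x y k
      exact (hb x y k.1).1 k.2
    rw [hM, sup_comm, inf_eq_right.2 (h1.2.2.1.le.trans hp)] at e1
    exact hne (cmi_eq h1 h2 e1)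
  obtain ⟨χ, c1, c2, c3⟩ := h.exists_max (h.sup_mem hk hdC) h1.2.1 hnp
  have kχ : κ ≤ χ := le_sup_left.trans c1
  have dχ : φ ⊓ ψ ≤ χ := le_sup_right.trans c1
  have key : ∀ {θ θ' : Setoid A}, IsCMI C θ p → IsCMI C θ' p → θ ⊓ θ' ≤ χ → κ ⊔ θ = p →
      χ ⊓ θ ≤ θ' := by
    intro θ θ' g g' d s
    have hnl : ¬ θ ≤ χ := fun hh => c2 (s ▸ sup_le kχ hh)
    rcases h.prime_tr g' g.1 g.2.2.1.le (h.inf_mem g.1 c3.1) (le_inf inf_le_left d)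
      inf_le_left with a | a
    · rw [inf_comm]; exact a
    · exact absurd (a ▸ inf_le_right) hnl
  have k1 := key h1 h2 dχ s1
  have k2 := key h2 h1 (by rw [inf_comm]; exact dχ) s2
  have hnl : ¬ φ ≤ χ := fun hh => c2 (s1 ▸ sup_le kχ hh)
  have e1 : φ ⊓ ψ = φ ⊓ χ := le_antisymm (le_inf inf_le_left dχ)
    (le_inf inf_le_left (by rw [inf_comm]; exact k1))
  have hnφψ : ¬ φ ≤ ψ := fun hh => hne (cmi_eq h1 h2 hh)
  have hpr : Projective C (ψ, p) (χ, χ ⊔ p) := by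
    refine (Relation.ReflTransGen.single (b := (φ ⊓ ψ, φ)) ?_).tail ?_
    · exact ⟨h2.1, h2.2.1, hdC, h1.1, Or.inr ⟨rfl, (h.cmi_sup h2 h1.1 h1.2.2.1.le hnφψ).symm⟩⟩
    · refine ⟨hdC, h1.1, c3.1, c3.2.1, Or.inl ⟨e1, ?_⟩⟩
      exact (h.cmi_sup c3 h1.1 (h1.2.2.1.le.trans le_sup_right) hnl).symm
  have hp := h.P _ _ _ _ h2 c3 hpr
  rw [← hp] at c3
  exact ⟨χ, c3, h.third h1 h2 c3 dχ k1 k2 (fun hh => hn (kχ.trans hh))⟩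

theorem HypS.linked_trans [Finite A] (h : HypS one C) {φ ψ χ p : Setoid A} (h1 : IsCMI C φ p)
    (h2 : IsCMI C ψ p) (h3 : IsCMI C χ p) (l1 : Linked C p φ ψ) (l2 : Linked C p ψ χ) :
    Linked C p φ χ := by
  by_cases n1 : φ = ψ
  · exact n1 ▸ l2
  by_cases n2 : ψ = χ
  · exact n2 ▸ l1
  by_cases n3 : φ = χ
  · exact n3 ▸ linked_refl h1
  obtain ⟨τ₁, g1, b1⟩ := h.third_exists h1 h2 n1 l1
  obtain ⟨τ₂, g2, b2⟩ := h.third_exists h2 h3 n2 l2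
  have r1 : ∀ x y, τ₁.r x y ↔ p.r x y ∧ (φ.r x y ↔ ψ.r x y) := fun x y => by rw [b1]; rfl
  have r2 : ∀ x y, τ₂.r x y ↔ p.r x y ∧ (ψ.r x y ↔ χ.r x y) := fun x y => by rw [b2]; rfl
  by_cases ht : τ₁ ⊓ τ₂ ≤ φ
  swap
  · refine ⟨τ₁ ⊓ τ₂, h.inf_mem g1.1 g2.1, inf_le_left.trans g1.2.2.1.le, ht, ?_⟩
    intro x y k
    exact ((r1 x y).1 k.1).2.trans ((r2 x y).1 k.2).2
  have nψφ : ¬ ψ ≤ φ := fun hh => n1 (cmi_eq h2 h1 hh).symm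
  by_cases hd : φ ⊓ ψ ≤ τ₂
  · have hd' : φ ⊓ ψ ≤ χ := fun x y k => ((r2 x y).1 (hd k)).2.1 k.2
    have hs := h.swap h1 h2 h3 hd' n2
    refine ⟨ψ, h2.1, h2.2.2.1.le, nψφ, ?_⟩
    intro x y k
    exact ⟨fun j => hd' (show (φ ⊓ ψ).r x y from ⟨j, k⟩),
      fun j => hs (show (ψ ⊓ χ).r x y from ⟨k, j⟩)⟩
  · exfalso
    have hdC := h.inf_mem h1.1 h2.1
    have hsup := h.cmi_sup g2 hdC (inf_le_left.trans h1.2.2.1.le) hd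
    have hle : φ ⊓ ψ ≤ τ₁ := fun x y k => (r1 x y).2
      ⟨h1.2.2.1.le k.1, ⟨fun _ => k.2, fun _ => k.1⟩⟩
    have hM := h.M (φ ⊓ ψ) hdC τ₂ g2.1 τ₁ g1.1 hle
    rw [hsup, inf_eq_right.2 g1.2.2.1.le] at hM
    have : τ₁ ≤ φ := by
      rw [← hM]
      exact sup_le inf_le_left (by rw [inf_comm]; exact ht)
    have e := cmi_eq g1 h1 this
    -- then φ ≤ ψ
    apply n1
    apply cmi_eq h1 h2
    intro x y k
    exact ((r1 x y).1 (e ▸ k)).2.1 k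

theorem HypS.proj_linked_aux [Finite A] (h : HypS one C) {φ p : Setoid A} (h1 : IsCMI C φ p)
    {rs : Setoid A × Setoid A} (hp : Projective C (φ, p) rs) :
    rs.1 ∈ C ∧ rs.2 ∈ C ∧ ∃ χ, IsCMI C χ p ∧ rs.1 = rs.2 ⊓ χ ∧ p = rs.2 ⊔ χ ∧
      Linked C p φ χ := by
  induction hp with
  | refl =>
    exact ⟨h1.1, h1.2.1, φ, h1, (inf_eq_right.2 h1.2.2.1.le).symm,
      (sup_eq_left.2 h1.2.2.1.le).symm, linked_refl h1⟩
  | @tail b c _ hstep ih =>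
    obtain ⟨r, s⟩ := b
    obtain ⟨r', s'⟩ := c
    obtain ⟨hr, hs, χ, hχ, e1, e2, hl⟩ := ih
    obtain ⟨-, -, hr', hs', hcase⟩ := hstep
    dsimp only at *
    refine ⟨hr', hs', ?_⟩
    have hsp : s ≤ p := e2 ▸ le_sup_left
    rcases hcase with ⟨u1, u2⟩ | ⟨d1, d2⟩
    · have hn : ¬ s' ≤ r' := by
        intro hh
        have : s ≤ r' := (u2 ▸ le_sup_left : s ≤ s').trans hh
        rw [inf_eq_left.2 this] at u1
        have : s ≤ χ := by rw [← u1, e1]; exact inf_le_right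
        rw [sup_eq_right.2 this] at e2
        exact absurd e2.le (not_le_of_gt hχ.2.2.1)
      obtain ⟨χ', c1, c2, c3⟩ := h.exists_max hr' hs' hn
      have nsχ' : ¬ s ≤ χ' := fun hh => c2 (u2 ▸ sup_le hh c1)
      have f1 : s ⊓ χ' = r := by
        rcases h.prime_tr hχ hs hsp (h.inf_mem hs c3.1) (x := s ⊓ χ')
          (by rw [← e1, u1]; exact le_inf inf_le_left (inf_le_right.trans c1))
          inf_le_left with a | a
        · apply le_antisymm
          · rw [e1]; exact le_inf inf_le_left a
          · rw [u1]; exact le_inf inf_le_left (inf_le_right.trans c1)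
        · exact absurd (a ▸ inf_le_right) nsχ'
      have f2 : χ' ⊔ s' = s ⊔ χ' := by
        rw [u2]
        apply le_antisymm
        · exact sup_le le_sup_right (sup_le le_sup_left (c1.trans le_sup_right))
        · exact sup_le (le_sup_left.trans le_sup_right) le_sup_left
      have hpr : Projective C (χ, p) (χ', χ' ⊔ s') := by
        refine (Relation.ReflTransGen.single (b := (r, s)) ?_).tail ?_
        · exact ⟨hχ.1, hχ.2.1, hr, hs, Or.inr ⟨e1, e2⟩⟩
        · exact ⟨hr, hs, c3.1, c3.2.1, Or.inl ⟨f1.symm, f2⟩⟩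
      have hp := h.P _ _ _ _ hχ c3 hpr
      rw [← hp] at c3
      refine ⟨χ', c3, ?_, ?_, ?_⟩
      · have hM := h.M r' hr' s hs χ' c3.1 c1
        rw [f1] at hM
        rw [u2, sup_comm s r', ← hM]
        symm
        apply sup_eq_left.2
        rw [u1]; exact inf_le_right
      · rw [hp, sup_comm]
      · apply h.linked_trans h1 hχ c3 hl
        refine ⟨s, hs, hsp, ?_, ?_⟩
        · intro hh
          rw [sup_eq_right.2 hh] at e2
          exact absurd e2.le (not_le_of_gt hχ.2.2.1)
        · intro x y k
          have e3 : s ⊓ χ = s ⊓ χ' := by rw [f1, e1]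
          constructor
          · intro j
            have : (s ⊓ χ).r x y := ⟨k, j⟩
            rw [e3] at this
            exact this.2
          · intro j
            have : (s ⊓ χ').r x y := ⟨k, j⟩
            rw [← e3] at this
            exact this.2
    · refine ⟨χ, hχ, ?_, ?_, hl⟩
      · have : s' ≤ s := d2 ▸ le_sup_left
        rw [d1, e1, ← inf_assoc, inf_eq_left.2 this]
      · rw [e2, d2]
        have : r ≤ χ := by rw [e1]; exact inf_le_right
        rw [sup_assoc, sup_eq_right.2 this]

theorem HypS.pip_iff [Finite A] (h : HypS one C) {φ η p : Setoid A} (hη : IsCMI C η p) :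
    PIP C φ η ↔ IsCMI C φ p ∧ Linked C p φ η := by
  constructor
  · rintro ⟨p', q, c1, c2, hp⟩
    have e1 : q = p := cmi_unique c2 hη
    subst e1
    have e2 := h.P _ _ _ _ c1 c2 hp
    subst e2
    obtain ⟨-, -, χ, hχ, f1, f2, hl⟩ := h.proj_linked_aux c1 hp
    dsimp only at f1 f2
    have : η = χ := cmi_eq c2 hχ (f1 ▸ inf_le_right)
    subst this
    exact ⟨c1, hl⟩
  · rintro ⟨c1, hl⟩
    exact ⟨p, p, c1, hη, h.linked_proj c1 hη hl⟩

/-- Theorem 10: the product of two distinct members of a class is in the class. -/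
theorem HypS.pip_bul [Finite A] (h : HypS one C) {φ ψ η p : Setoid A} (hη : IsCMI C η p)
    (hφ : PIP C φ η) (hψ : PIP C ψ η) (hne : φ ≠ ψ) : ∃ σ, PIP C σ η ∧ σ.r = Bul p φ ψ := by
  obtain ⟨c1, l1⟩ := (h.pip_iff hη).1 hφ
  obtain ⟨c2, l2⟩ := (h.pip_iff hη).1 hψ
  obtain ⟨σ, cσ, eσ⟩ := h.third_exists c1 c2 hne (h.linked_trans c1 hη c2 l1 (linked_symm l2))
  refine ⟨σ, (h.pip_iff hη).2 ⟨cσ, ?_⟩, eσ⟩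
  apply linked_symm
  apply h.linked_trans hη c1 cσ (linked_symm l1)
  refine ⟨ψ, c2.1, c2.2.2.1.le, fun hh => hne (cmi_eq c2 c1 hh).symm, ?_⟩
  intro x y k
  rw [eσ]
  exact ⟨fun j => ⟨c1.2.2.1.le j, ⟨fun _ => k, fun _ => j⟩⟩, fun j => j.2.2 k⟩

end

section
variable {one : A} {C : Set (Setoid A)}

theorem r_iff {σ p φ ψ : Setoid A} (e : σ.r = Bul p φ ψ) (x y : A) :
    σ.r x y ↔ p.r x y ∧ (φ.r x y ↔ ψ.r x y) := by rw [e]; rfl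

theorem HypS.bar_le [Finite A] (h : HypS one C) {φ η p : Setoid A} (hη : IsCMI C η p)
    (hφ : φ ∈ {φ | PIP C φ η} ∪ {p}) : φ ≤ p := by
  rcases hφ with hφ | hφ
  · exact ((h.pip_iff hη).1 hφ).1.2.2.1.le
  · exact le_of_eq hφ

theorem HypS.bar_bul [Finite A] (h : HypS one C) {φ ψ η p : Setoid A} (hη : IsCMI C η p)
    (hφ : φ ∈ {φ | PIP C φ η} ∪ {p}) (hψ : ψ ∈ {φ | PIP C φ η} ∪ {p}) :
    ∃ σ ∈ {φ | PIP C φ η} ∪ {p}, σ.r = Bul p φ ψ := by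
  have l1 := h.bar_le hη hφ
  have l2 := h.bar_le hη hψ
  by_cases e : φ = ψ
  · subst e
    refine ⟨p, Or.inr rfl, ?_⟩
    funext x y; apply propext
    exact ⟨fun k => ⟨k, Iff.rfl⟩, fun k => k.1⟩
  rcases hφ with hφ | hφ
  · rcases hψ with hψ | hψ
    · obtain ⟨σ, h1, h2⟩ := h.pip_bul hη hφ hψ e
      exact ⟨σ, Or.inl h1, h2⟩
    · obtain rfl : ψ = p := hψ
      refine ⟨φ, Or.inl hφ, ?_⟩
      funext x y; apply propext
      exact ⟨fun k => ⟨l1 k, fun _ => l1 k, fun _ => k⟩, fun k => k.2.2 k.1⟩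
  · obtain rfl : φ = p := hφ
    refine ⟨ψ, hψ, ?_⟩
    funext x y; apply propext
    exact ⟨fun k => ⟨l2 k, fun _ => k, fun _ => l2 k⟩, fun k => k.2.1 k.1⟩

theorem HypS.p_of_plus [Finite A] (h : HypS one C) {η p : Setoid A} (hη : IsCMI C η p) {x y : A}
    (hp : ∀ θ ∈ CmSet C, η < θ → θ.r x y) : p.r x y := by
  by_contra hn
  obtain ⟨χ, c1, c2, c3⟩ := h.exists_sep hη.2.1 hn
  exact c2 (hp χ c3 (hη.2.2.1.trans_le c1))

theorem HypS.hered_M [Finite A] (h : HypS one C) (a : A) : Hered C (MsetA C one a) := by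
  refine ⟨fun μ hμ => hμ.1, fun μ hμ ν p hν hle => ⟨⟨p, hν⟩, hle hμ.2⟩, ?_⟩
  intro η p hη hpl
  have pa : p.r one a := h.p_of_plus hη (fun θ h1 h2 => (hpl ⟨h1, h2⟩).2)
  have memH : ∀ φ, φ ∈ MsetA C one a ∩ {φ | PIP C φ η} ∪ {p} ↔
      φ ∈ {φ | PIP C φ η} ∪ {p} ∧ φ.r one a := by
    intro φ
    constructor
    · rintro (⟨h1, h2⟩ | h1)
      · exact ⟨Or.inl h2, h1.2⟩
      · obtain rfl : φ = p := h1
        exact ⟨Or.inr rfl, pa⟩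
    · rintro ⟨h1 | h1, h2⟩
      · exact Or.inl ⟨⟨⟨p, ((h.pip_iff hη).1 h1).1⟩, h2⟩, h1⟩
      · exact Or.inr h1
  generalize MsetA C one a ∩ {φ | PIP C φ η} ∪ {p} = H at memH
  by_cases hall : H = {φ | PIP C φ η} ∪ {p}
  · exact Or.inl hall
  right
  refine ⟨⟨fun φ hφ => ((memH φ).1 hφ).1, (memH p).2 ⟨Or.inr rfl, pa⟩, ?_⟩, hall, ?_⟩
  · intro φ hφ ψ hψ
    rw [memH] at hφ hψ
    obtain ⟨σ, s1, s2⟩ := h.bar_bul hη hφ.1 hψ.1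
    refine ⟨σ, (memH σ).2 ⟨s1, ?_⟩, s2⟩
    rw [r_iff s2]
    exact ⟨pa, fun _ => hψ.2, fun _ => hφ.2⟩
  · intro K hK hHK
    by_cases hKH : K = H
    · exact Or.inl hKH
    right
    have : ∃ ψ ∈ K, ψ ∉ H := by
      by_contra hcon
      push Not at hcon
      exact hKH (Set.Subset.antisymm hcon hHK)
    obtain ⟨ψ, ψK, ψH⟩ := this
    have nψ : ¬ ψ.r one a := fun hh => ψH ((memH ψ).2 ⟨hK.1 ψK, hh⟩)
    apply Set.Subset.antisymm hK.1
    intro φ hφ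
    by_cases fa : φ.r one a
    · exact hHK ((memH φ).2 ⟨hφ, fa⟩)
    obtain ⟨σ, s1, s2⟩ := h.bar_bul hη hφ (hK.1 ψK)
    have σK : σ ∈ K := by
      apply hHK
      rw [memH]
      refine ⟨s1, ?_⟩
      rw [r_iff s2]
      exact ⟨pa, fun k => absurd k fa, fun k => absurd k nψ⟩
    obtain ⟨τ, t1, t2⟩ := hK.2.2 σ σK ψ ψK
    have : τ = φ := by
      apply eq_of_r; funext x y; apply propext
      rw [r_iff t2, r_iff s2]
      have := h.bar_le hη hφ (x := x) (y := y)
      change φ.r x y → p.r x y at this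
      tauto
    exact this ▸ t1

theorem HypS.zeta [Finite A] (h : HypS one C) {η p : Setoid A} (hη : IsCMI C η p)
    {Z : Set (Setoid A)}
    (hZ : Z ∩ {φ | PIP C φ η} ∪ {p} = {φ | PIP C φ η} ∪ {p} ∨
      IsHyperplaneU C η p (Z ∩ {φ | PIP C φ η} ∪ {p}))
    {φ ψ σ : Setoid A} (hφ : PIP C φ η) (hψ : PIP C ψ η) (hσ : PIP C σ η)
    (e : σ.r = Bul p φ ψ) : σ ∈ Z ↔ (φ ∈ Z ↔ ψ ∈ Z) := by
  have memH : ∀ φ, PIP C φ η → (φ ∈ Z ∩ {φ | PIP C φ η} ∪ {p} ↔ φ ∈ Z) := by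
    intro φ hφ
    constructor
    · rintro (h1 | h1)
      · exact h1.1
      · obtain rfl : φ = p := h1
        exact absurd ((h.pip_iff hη).1 hφ).1.2.2.1 (lt_irrefl _)
    · exact fun h1 => Or.inl ⟨h1, hφ⟩
  rw [← memH _ hφ, ← memH _ hψ, ← memH _ hσ]
  generalize Z ∩ {φ | PIP C φ η} ∪ {p} = H at hZ
  rcases hZ with rfl | ⟨⟨hsub, hpH, hcl⟩, hne, hmax⟩
  · exact ⟨fun _ => ⟨fun _ => Or.inl hψ, fun _ => Or.inl hφ⟩, fun _ => Or.inl hσ⟩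
  have cl : ∀ {φ ψ σ : Setoid A}, φ ∈ H → ψ ∈ H → σ.r = Bul p φ ψ → σ ∈ H := by
    intro φ ψ σ h1 h2 e
    obtain ⟨τ, t1, t2⟩ := hcl φ h1 ψ h2
    rwa [eq_of_r (e.trans t2.symm)]
  have lφ : ∀ x y, φ.r x y → p.r x y := fun x y => h.bar_le hη (Or.inl hφ) (x := x) (y := y)
  have lψ : ∀ x y, ψ.r x y → p.r x y := fun x y => h.bar_le hη (Or.inl hψ) (x := x) (y := y)
  have e2 : ψ.r = Bul p σ φ := by
    funext x y; apply propext
    have h1 := r_iff e x y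
    have h2 := lφ x y
    have h3 := lψ x y
    show _ ↔ p.r x y ∧ _
    tauto
  have e3 : φ.r = Bul p σ ψ := by
    funext x y; apply propext
    have h1 := r_iff e x y
    have h2 := lφ x y
    have h3 := lψ x y
    show _ ↔ p.r x y ∧ _
    tauto
  constructor
  · intro s
    exact ⟨fun k => cl s k e2, fun k => cl s k e3⟩
  · intro hiff
    by_cases f : φ ∈ H
    · exact cl f (hiff.1 f) e
    have nψ : ψ ∉ H := fun k => f (hiff.2 k)
    let K : Set (Setoid A) := {χ | χ ∈ H ∨ (χ ∈ {φ | PIP C φ η} ∪ {p} ∧ ∃ k ∈ H, χ.r = Bul p k φ)}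
    have hK : SubgrpU C η p K := by
      refine ⟨?_, Or.inl hpH, ?_⟩
      · rintro χ (h1 | h1)
        · exact hsub h1
        · exact h1.1
      have mixed : ∀ χ₁ ∈ H, ∀ χ₂, (∃ k ∈ H, χ₂.r = Bul p k φ) →
          ∃ σ ∈ K, σ.r = Bul p χ₁ χ₂ := by
        rintro χ₁ h1 χ₂ ⟨k, k1, k2⟩
        obtain ⟨m, m1, m2⟩ := hcl χ₁ h1 k k1
        obtain ⟨s, s1, s2⟩ := h.bar_bul hη (hsub m1) (Or.inl hφ)
        refine ⟨s, Or.inr ⟨s1, m, m1, s2⟩, ?_⟩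
        funext x y; apply propext
        rw [r_iff s2, r_iff m2]
        show _ ↔ p.r x y ∧ _
        rw [r_iff k2]
        tauto
      rintro χ₁ (h1 | ⟨h1, h1'⟩) χ₂ (h2 | ⟨h2, h2'⟩)
      · obtain ⟨m, m1, m2⟩ := hcl χ₁ h1 χ₂ h2
        exact ⟨m, Or.inl m1, m2⟩
      · exact mixed χ₁ h1 χ₂ h2'
      · obtain ⟨s, s1, s2⟩ := mixed χ₂ h2 χ₁ h1'
        refine ⟨s, s1, ?_⟩
        funext x y; apply propext
        rw [r_iff s2]
        show _ ↔ p.r x y ∧ _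
        tauto
      · obtain ⟨k, k1, k2⟩ := h1'
        obtain ⟨l, l1, l2⟩ := h2'
        obtain ⟨m, m1, m2⟩ := hcl k k1 l l1
        refine ⟨m, Or.inl m1, ?_⟩
        funext x y; apply propext
        rw [r_iff m2]
        show _ ↔ p.r x y ∧ _
        rw [r_iff k2, r_iff l2]
        tauto
    have φK : φ ∈ K := by
      refine Or.inr ⟨Or.inl hφ, p, hpH, ?_⟩
      funext x y; apply propext
      show _ ↔ p.r x y ∧ _
      have := lφ x y
      tauto
    rcases hmax K hK (fun x hx => Or.inl hx) with hh | hh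
    · exact absurd (hh ▸ φK) f
    · have : ψ ∈ K := by rw [hh]; exact Or.inl hψ
      rcases this with k | ⟨-, k, k1, k2⟩
      · exact absurd k nψ
      · have : k = σ := by
          apply eq_of_r; funext x y; apply propext
          rw [r_iff e, r_iff k2]
          have := h.bar_le hη (hsub k1) (x := x) (y := y)
          change k.r x y → p.r x y at this
          tauto
        exact this ▸ k1

theorem HypS.pip_euc [Finite A] (h : HypS one C) {ν μ η : Setoid A} (h1 : PIP C ν μ)
    (h2 : PIP C ν η) : PIP C μ η := by
  obtain ⟨-, q, -, hμ, -⟩ := id h1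
  obtain ⟨-, p, -, hη, -⟩ := id h2
  obtain ⟨c1, l1⟩ := (h.pip_iff hμ).1 h1
  obtain ⟨c2, l2⟩ := (h.pip_iff hη).1 h2
  obtain rfl := cmi_unique c1 c2
  exact (h.pip_iff hη).2 ⟨hμ, h.linked_trans hμ c1 hη (linked_symm l1) l2⟩

theorem HypS.pip_refl [Finite A] (h : HypS one C) {η p : Setoid A} (hη : IsCMI C η p) :
    PIP C η η := (h.pip_iff hη).2 ⟨hη, linked_refl hη⟩

/-- `K` is closed under products: then the meet of `W ∪ K` is below no other class member. -/
theorem HypS.meet_mem [Finite A] (h : HypS one C) {η₀ p : Setoid A} (hη₀ : IsCMI C η₀ p)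
    {W K : Set (Setoid A)} (hWC : W ⊆ CmSet C)
    (hWup : ∀ μ ∈ W, ∀ ν ∈ CmSet C, μ ≤ ν → ν ∈ W) (hWU : ∀ μ ∈ W, ¬ PIP C μ η₀)
    (hKU : ∀ φ ∈ K, PIP C φ η₀)
    (hKcl : ∀ φ ∈ K, ∀ ψ ∈ K, ∀ σ, PIP C σ η₀ → σ.r = Bul p φ ψ → σ ∈ K)
    (S : Set (Setoid A)) (hS : S.Finite) (hSW : S ⊆ W ∪ K) :
    ∀ η, PIP C η η₀ → sInf S ≤ η → η ∈ K := by
  have hC : W ∪ K ⊆ C := by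
    rintro x (hx | hx)
    · obtain ⟨q, hq⟩ := hWC hx; exact hq.1
    · exact ((h.pip_iff hη₀).1 (hKU x hx)).1.1
  induction S, hS using Set.Finite.induction_on with
  | empty =>
    intro η hη hle
    rw [sInf_empty] at hle
    have := ((h.pip_iff hη₀).1 hη).1.2.2.1
    exact absurd (lt_of_lt_of_le this (le_top.trans hle)) (lt_irrefl _)
  | @insert s S _ _ ih =>
    intro η hη hle
    rw [sInf_insert] at hle
    have hsub : S ⊆ W ∪ K := (Set.subset_insert s S).trans hSW
    have hs : s ∈ W ∪ K := hSW (Set.mem_insert s S)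
    have hηc := ((h.pip_iff hη₀).1 hη).1
    obtain ⟨μ₁, μ₂, d1, d2, l1, l2, l3⟩ :=
      h.D s (hC hs) (sInf S) (h.inf _ (hsub.trans hC)) η p hηc hle
    have toU : ∀ {μ}, PIP C μ η → PIP C μ η₀ := by
      intro μ hμ
      have h1 : PIP C η μ := h.pip_euc hμ (h.pip_refl ((h.pip_iff hηc).1 hμ).1)
      exact h.pip_euc h1 hη
    have m2 : μ₂ = ⊤ ∨ μ₂ ∈ K := d2.imp_right (fun d => ih hsub μ₂ (toU d) l2)
    have m1 : μ₁ = ⊤ ∨ μ₁ ∈ K := by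
      refine d1.imp_right (fun d => ?_)
      have hμ := toU d
      have c := ((h.pip_iff hη₀).1 hμ).1
      rcases hs with hs | hs
      · exact absurd hμ (hWU _ (hWup s hs μ₁ ⟨p, c⟩ l1))
      · rw [← cmi_eq ((h.pip_iff hη₀).1 (hKU s hs)).1 c l1]; exact hs
    have single : ∀ μ ∈ K, μ ≤ η → η ∈ K := by
      intro μ hμ hl
      rw [← cmi_eq ((h.pip_iff hη₀).1 (hKU μ hμ)).1 hηc hl]; exact hμ
    rcases m1 with rfl | m1
    · rw [top_inf_eq] at l3
      rcases m2 with rfl | m2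
      · exact absurd (lt_of_lt_of_le hηc.2.2.1 (le_top.trans l3)) (lt_irrefl _)
      · exact single _ m2 l3
    · rcases m2 with rfl | m2
      · rw [inf_top_eq] at l3
        exact single _ m1 l3
      · have c1 := ((h.pip_iff hη₀).1 (hKU _ m1)).1
        have c2 := ((h.pip_iff hη₀).1 (hKU _ m2)).1
        by_cases n1 : μ₁ = η
        · exact n1 ▸ m1
        by_cases n2 : μ₂ = η
        · exact n2 ▸ m2
        have k2 := h.swap c1 c2 hηc l3 n2
        have k1 := h.swap c2 c1 hηc (by rw [inf_comm]; exact l3) n1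
        refine hKcl _ m1 _ m2 η hη (h.third c1 c2 hηc l3 (by rw [inf_comm]; exact k1)
          (by rw [inf_comm]; exact k2) (fun hh => n1 (cmi_eq hηc c1 hh).symm))

theorem HypS.M_e (h : HypS one C) {e : A → A → A}
    (he : ∀ a b : A, theta C a b = theta C one (e a b)) {μ : Setoid A} (hμ : μ ∈ C) (a b : A) :
    μ.r one (e a b) ↔ μ.r a b := by
  rw [← theta_le hμ, ← he, theta_le hμ]

theorem HypS.step [Finite A] (h : HypS one C) {e : A → A → A}
    (he : ∀ a b : A, theta C a b = theta C one (e a b)) {Z : Set (Setoid A)} (hZ : Hered C Z)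
    {η p : Setoid A} (hη : IsCMI C η p) {W : Set (Setoid A)} (hWC : W ⊆ CmSet C)
    (hWup : ∀ μ ∈ W, ∀ ν ∈ CmSet C, μ ≤ ν → ν ∈ W) (hWU : ∀ μ ∈ W, ¬ PIP C μ η)
    (hplus : ∀ θ ∈ CmSet C, η < θ → θ ∈ W) {a : A} (ha : ∀ μ ∈ W, (μ.r one a ↔ μ ∈ Z)) :
    ∃ a', (∀ μ ∈ W, (μ.r one a' ↔ μ ∈ Z)) ∧ ∀ φ, PIP C φ η → (φ.r one a' ↔ φ ∈ Z) := by
  by_cases hpl : {θ | (∃ q, IsCMI C θ q) ∧ η < θ} ⊆ Z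
  swap
  · refine ⟨a, ha, ?_⟩
    intro φ hφ
    have c := ((h.pip_iff hη).1 hφ).1
    obtain ⟨θ, ⟨⟨q, hq⟩, hlt⟩, hθZ⟩ := Set.not_subset.1 hpl
    have hle : φ ≤ θ := c.2.2.1.le.trans (hη.2.2.2 θ hq.1 hlt)
    constructor
    · intro k
      exact absurd ((ha θ (hplus θ ⟨q, hq⟩ hlt)).1 (hle k)) hθZ
    · intro k
      exact absurd (hZ.2.1 φ k θ q hq hle) hθZ
  have pa : p.r one a := h.p_of_plus hη (fun θ h1 h2 => (ha θ (hplus θ h1 h2)).2 (hpl ⟨h1, h2⟩))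
  have hz := hZ.2.2 η p hη hpl
  let K : Set (Setoid A) := {φ | PIP C φ η ∧ (φ ∈ Z ↔ φ.r one a)}
  have hK : ∀ φ ψ σ, PIP C φ η → PIP C ψ η → PIP C σ η → σ.r = Bul p φ ψ →
      (σ ∈ K ↔ (φ ∈ K ↔ ψ ∈ K)) := by
    intro φ ψ σ h1 h2 h3 e
    have z := h.zeta hη hz h1 h2 h3 e
    have r := r_iff e one a
    have k1 : φ ∈ K ↔ (φ ∈ Z ↔ φ.r one a) := ⟨fun k => k.2, fun k => ⟨h1, k⟩⟩
    have k2 : ψ ∈ K ↔ (ψ ∈ Z ↔ ψ.r one a) := ⟨fun k => k.2, fun k => ⟨h2, k⟩⟩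
    have k3 : σ ∈ K ↔ (σ ∈ Z ↔ σ.r one a) := ⟨fun k => k.2, fun k => ⟨h3, k⟩⟩
    rw [k1, k2, k3, z, r]
    clear k1 k2 k3 z r
    tauto
  by_cases hall : ∀ φ, PIP C φ η → φ ∈ K
  · exact ⟨a, ha, fun φ hφ => (hall φ hφ).2.symm⟩
  push Not at hall
  obtain ⟨ρ, hρ, ρK⟩ := hall
  have cρ := ((h.pip_iff hη).1 hρ).1
  have hfin : (W ∪ K).Finite := by
    have : Finite (Setoid A) := Finite.of_injective (fun r : Setoid A => r.r)
      (fun _ _ h => eq_of_r h)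
    exact Set.toFinite _
  have hWKC : W ∪ K ⊆ C := by
    rintro x (hx | hx)
    · obtain ⟨q, hq⟩ := hWC hx; exact hq.1
    · exact ((h.pip_iff hη).1 hx.1).1.1
  have hγ : ¬ sInf (W ∪ K) ≤ ρ := fun hle => ρK (h.meet_mem hη hWC hWup hWU (K := K)
    (fun φ k => k.1) (fun φ k1 ψ k2 σ k3 e => (hK φ ψ σ k1.1 k2.1 k3 e).2
      ⟨fun _ => k2, fun _ => k1⟩) (W ∪ K) hfin (le_refl _) ρ hρ hle)
  have hγC := h.inf _ hWKC
  have : ∃ c, (sInf (W ∪ K)).r one c ∧ ¬ ρ.r one c := by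
    by_contra hcon
    push Not at hcon
    apply hγ
    rw [← inf_eq_left]
    apply h.R _ (h.inf_mem hγC cρ.1) _ hγC
    intro x
    exact ⟨fun k => k.1, fun k => ⟨k, hcon x k⟩⟩
  obtain ⟨c, c1, c2⟩ := this
  have cW : ∀ μ ∈ W ∪ K, μ.r one c := fun μ hμ => (sInf_le hμ : sInf (W ∪ K) ≤ μ) c1
  have pc : p.r one c := h.p_of_plus hη (fun θ h1 h2 => cW θ (Or.inl (hplus θ h1 h2)))
  have cK : ∀ φ, PIP C φ η → (φ.r one c ↔ φ ∈ K) := by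
    intro φ hφ
    refine ⟨fun k => ?_, fun k => cW φ (Or.inr k)⟩
    by_contra nK
    have hne : φ ≠ ρ := fun e => c2 (e ▸ k)
    obtain ⟨σ, s1, s2⟩ := h.pip_bul hη hφ hρ hne
    have σK : σ ∈ K := (hK φ ρ σ hφ hρ s1 s2).2 ⟨fun j => absurd j nK, fun j => absurd j ρK⟩
    have := (r_iff s2 one c).1 (cW σ (Or.inr σK))
    exact c2 (this.2.1 k)
  refine ⟨e a c, ?_, ?_⟩
  · intro μ hμ
    rw [h.M_e he (hWKC (Or.inl hμ)), ← ha μ hμ]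
    have := cW μ (Or.inl hμ)
    exact ⟨fun k => μ.trans this (μ.symm k), fun k => μ.trans (μ.symm k) this⟩
  · intro φ hφ
    have cφ := ((h.pip_iff hη).1 hφ).1
    rw [h.M_e he cφ.1]
    have key : φ.r a c ↔ (φ.r one a ↔ φ.r one c) := by
      constructor
      · intro k
        exact ⟨fun j => φ.trans j k, fun j => φ.trans j (φ.symm k)⟩
      · intro hiff
        rcases h.two cφ pa (p.trans (p.symm pa) pc) with t | t | t
        · exact φ.trans (φ.symm t) (hiff.1 t)
        · exact t
        · exact φ.trans (φ.symm (hiff.2 t)) t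
    rw [key, cK φ hφ]
    have : φ ∈ K ↔ (φ ∈ Z ↔ φ.r one a) := ⟨fun k => k.2, fun k => ⟨hφ, k⟩⟩
    rw [this]
    tauto

theorem HypS.surj [Finite A] (h : HypS one C) {e : A → A → A}
    (he : ∀ a b : A, theta C a b = theta C one (e a b)) {Z : Set (Setoid A)} (hZ : Hered C Z) :
    ∀ n : ℕ, ∀ W : Set (Setoid A), W.ncard = n → W ⊆ CmSet C →
      (∀ μ ∈ W, ∀ ν ∈ CmSet C, μ ≤ ν → ν ∈ W) → (∀ μ ∈ W, ∀ ν, PIP C ν μ → ν ∈ W) →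
      ∃ a, ∀ μ ∈ W, (μ.r one a ↔ μ ∈ Z) := by
  have hF : Finite (Setoid A) := Finite.of_injective (fun r : Setoid A => r.r)
    (fun _ _ h => eq_of_r h)
  intro n
  induction n using Nat.strong_induction_on with
  | _ n ih =>
    intro W hn hWC hWup hWpip
    by_cases hemp : W = ∅
    · exact ⟨one, by simp [hemp]⟩
    obtain ⟨η₁, hη₁⟩ := Set.nonempty_iff_ne_empty.2 hemp
    obtain ⟨p₁, hp₁⟩ := hWC hη₁
    obtain ⟨p, hpmin⟩ := (Set.toFinite {p | ∃ η ∈ W, IsCMI C η p}).exists_minimal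
      ⟨p₁, η₁, hη₁, hp₁⟩
    obtain ⟨η, hηW, hη⟩ := hpmin.prop
    have hlt : (W \ {φ | PIP C φ η}).ncard < n := by
      rw [← hn]
      apply Set.ncard_lt_ncard _ (Set.toFinite _)
      refine ⟨Set.diff_subset, fun hh => ?_⟩
      exact (hh hηW).2 (h.pip_refl hη)
    have hup' : ∀ μ ∈ W \ {φ | PIP C φ η}, ∀ ν ∈ CmSet C, μ ≤ ν → ν ∈ W \ {φ | PIP C φ η} := by
      rintro μ ⟨hμ, hμ'⟩ ν hν hle
      refine ⟨hWup μ hμ ν hν hle, fun hν' => ?_⟩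
      have c := ((h.pip_iff hη).1 hν').1
      have hne : μ ≠ ν := fun e => hμ' (e ▸ hν')
      obtain ⟨q, hq⟩ := hWC hμ
      have hqν := hq.2.2.2 ν c.1 (lt_of_le_of_ne hle hne)
      have hqp : q < p := hqν.trans_lt c.2.2.1
      exact absurd (hpmin.le_of_le ⟨μ, hμ, hq⟩ hqp.le) (not_le_of_gt hqp)
    obtain ⟨a, ha⟩ := ih _ hlt (W \ {φ | PIP C φ η}) rfl (Set.diff_subset.trans hWC) hup' (by
      rintro μ ⟨hμ, hμ'⟩ ν hν
      exact ⟨hWpip μ hμ ν hν, fun hν' => hμ' (h.pip_euc hν hν')⟩)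
    obtain ⟨a', g1, g2⟩ := h.step he hZ hη (Set.diff_subset.trans hWC) hup' (fun μ hμ => hμ.2)
      (fun θ hθ hl => ⟨hWup η hηW θ hθ hl.le, fun hθ' => by
        have c := ((h.pip_iff hη).1 hθ').1
        exact absurd (hη.2.2.2 θ c.1 hl) (not_le_of_gt c.2.2.1)⟩) ha
    refine ⟨a', fun μ hμ => ?_⟩
    by_cases hU : PIP C μ η
    · exact g2 μ hU
    · exact g1 μ ⟨hμ, hU⟩

end

/-- Theorem 24, part 2: for a finite congruence orderable algebra with a principal
congruence (Malcev) term `e`, the map `a ↦ M(a) = {μ ∈ Cm : (1,a) ∈ μ}` is a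
bijection from `A` onto the family `ℋ` of hereditary subsets of `Cm`, and
`M(e(a,b)) = M(a) ↔ M(b)`; hence `(A, e)` is isomorphic to `(ℋ, ↔)`. -/
theorem stmt19 [Finite A] (one : A) (C : Set (Setoid A))
    (hInf : ∀ S ⊆ C, sInf S ∈ C) (hSup : ∀ S ⊆ C, sSup S ∈ C)
    (hDir : ∀ D ⊆ C, D.Nonempty → DirectedOn (· ≤ ·) D →
      ∀ x y : A, (sSup D).r x y ↔ ∃ s ∈ D, s.r x y)
    (hM : ∀ x ∈ C, ∀ y ∈ C, ∀ z ∈ C, x ≤ z → x ⊔ y ⊓ z = (x ⊔ y) ⊓ z)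
    (hO : ∀ α ∈ C, ∀ a b : A, α ⊔ theta C one a = α ⊔ theta C one b ↔ α.r a b)
    (hR : ∀ α ∈ C, ∀ β ∈ C, (∀ x : A, α.r one x ↔ β.r one x) → α = β)
    (hP : ∀ φ ψ p q : Setoid A, IsCMI C φ p → IsCMI C ψ q →
      Projective C (φ, p) (ψ, q) → p = q)
    (hD : ∀ α ∈ C, ∀ β ∈ C, ∀ η p, IsCMI C η p → α ⊓ β ≤ η →
      ∃ μ₁ μ₂ : Setoid A, (μ₁ = ⊤ ∨ PIP C μ₁ η) ∧ (μ₂ = ⊤ ∨ PIP C μ₂ η) ∧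
        α ≤ μ₁ ∧ β ≤ μ₂ ∧ μ₁ ⊓ μ₂ ≤ η)
    (e : A → A → A) (he : ∀ a b : A, theta C a b = theta C one (e a b)) :
    (∀ a b : A, MsetA C one a = MsetA C one b → a = b) ∧
    (∀ a : A, Hered C (MsetA C one a)) ∧
    (∀ Z : Set (Setoid A), Hered C Z → ∃ a : A, MsetA C one a = Z) ∧
    (∀ a b : A, MsetA C one (e a b) = EqOpU C (MsetA C one a) (MsetA C one b)) := by
  have h : HypS one C := ⟨hInf, hSup, hM, hO, hR, hP, hD⟩
  have rel : ∀ α ∈ C, ∀ a b : A, (∀ μ ∈ CmSet C, α ≤ μ → (μ.r one a ↔ μ.r one b)) → α.r a b := by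
    have half : ∀ α ∈ C, ∀ a b : A, (∀ μ ∈ CmSet C, α ≤ μ → (μ.r one a ↔ μ.r one b)) →
        α ⊔ theta C one a ≤ α ⊔ theta C one b := by
      intro α hα a b hab
      have hβ := h.sup_mem hα (h.theta_mem one b)
      refine sup_le le_sup_left ?_
      rw [theta_le hβ]
      by_contra hn
      obtain ⟨χ, c1, c2, c3⟩ := h.exists_sep hβ hn
      apply c2
      rw [hab χ c3 (le_sup_left.trans c1)]
      exact (le_sup_right.trans c1) (theta_rel one b)
    intro α hα a b hab
    rw [← hO α hα]
    exact le_antisymm (half α hα a b hab) (half α hα b a (fun μ h1 h2 => (hab μ h1 h2).symm))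
  refine ⟨?_, h.hered_M, ?_, ?_⟩
  · intro a b hab
    have : (⊥ : Setoid A).r a b := by
      apply rel ⊥ h.bot_mem
      intro μ hμ _
      have := Set.ext_iff.1 hab μ
      exact ⟨fun k => (this.1 ⟨hμ, k⟩).2, fun k => (this.2 ⟨hμ, k⟩).2⟩
    exact this
  · intro Z hZ
    obtain ⟨a, ha⟩ := h.surj he hZ _ (CmSet C) rfl (le_refl _) (fun _ _ ν hν _ => hν)
      (fun _ _ ν hν => by obtain ⟨p, -, hp, -⟩ := hν; exact ⟨p, hp⟩)
    refine ⟨a, ?_⟩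
    ext μ
    exact ⟨fun k => (ha μ k.1).1 k.2, fun k => ⟨hZ.1 μ k, (ha μ (hZ.1 μ k)).2 k⟩⟩
  · intro a b
    ext μ
    constructor
    · rintro ⟨hμ, hr⟩
      obtain ⟨p, hp⟩ := id hμ
      rw [h.M_e he hp.1] at hr
      refine ⟨hμ, ?_⟩
      rintro ⟨-, φ, (⟨h1, h2⟩ | ⟨h1, h2⟩), hle⟩
      · exact h2 ⟨h1.1, φ.trans h1.2 (hle hr)⟩
      · exact h2 ⟨h1.1, φ.trans h1.2 (φ.symm (hle hr))⟩
    · rintro ⟨hμ, hn⟩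
      obtain ⟨p, hp⟩ := id hμ
      refine ⟨hμ, ?_⟩
      rw [h.M_e he hp.1]
      apply rel μ hp.1
      intro φ hφ hle
      by_contra hcon
      apply hn
      refine ⟨hμ, φ, ?_, hle⟩
      by_cases f : φ.r one a
      · exact Or.inl ⟨⟨hφ, f⟩, fun k => hcon ⟨fun _ => k.2, fun _ => f⟩⟩
      · refine Or.inr ⟨⟨hφ, ?_⟩, fun k => f k.2⟩
        by_contra g
        exact hcon ⟨fun k => absurd k f, fun k => absurd k g⟩
end
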